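/- arXiv:1302.0336 — 3 statements merged into one kernel-verified Lean document; each statement's English description precedes it below -/
import Mathlib

section
/- Let f, f_1, …, f_m : (0,∞) → ℝ be convex functions with f(1) = f_i(1) = 0, and let D_1, …, D_m ≥ 0. Then A(D_1,…,D_m) = A_{m+2}(D_1,…,D_m); that is, the supremum of D_f(P‖Q) over all pairs of probability measures P, Q on all possible measurable spaces subject to D_{f_i}(P‖Q) ≤ D_i for all i = 1,…,m equals the supremum of D_f(P‖Q) over pairs of probability measures P, Q on the finite set {1,…,m+2} subject to the same constraints. -/
open MeasureTheory Filter Set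
open scoped ENNReal NNReal Classical

noncomputable section

/-- The limit of `f` at `0` from the right, as an extended real number
(for `f` convex on `(0,∞)` the `limsup` below is the actual limit). -/
def limAtZero (f : ℝ → ℝ) : EReal :=
  Filter.limsup (fun x => (f x : EReal)) (nhdsWithin 0 (Set.Ioi 0))

/-- The limit of `f x / x` as `x → ∞`, as an extended real number
(for `f` convex on `(0,∞)` the `limsup` below is the actual limit). -/
def derivAtTop (f : ℝ → ℝ) : EReal :=
  Filter.limsup (fun x => ((f x / x : ℝ) : EReal)) Filter.atTop

/-- The `f`-divergence `D_f(P‖Q) = ∫_{q>0} f(p/q) dQ + f'(∞) P{q = 0}`, where the part of the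
integral over `{p = 0, q > 0}` is interpreted via the limit `f(0) := lim_{x↓0} f x`, and the part
over `{q = 0}` (the `Q`-singular part of `P`) via `f'(∞) := lim_{x→∞} f x / x`. -/
def fDiv (f : ℝ → ℝ) {Ω : Type*} [MeasurableSpace Ω] (P Q : Measure Ω) : EReal :=
  (if Integrable (fun x => f ((Measure.rnDeriv P Q x).toReal))
      (Q.restrict {x | Measure.rnDeriv P Q x ≠ 0})
   then ((∫ x in {x | Measure.rnDeriv P Q x ≠ 0},
       f ((Measure.rnDeriv P Q x).toReal) ∂Q : ℝ) : EReal)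
   else (⊤ : EReal))
  + limAtZero f * ((Q {x | Measure.rnDeriv P Q x = 0} : ℝ≥0∞) : EReal)
  + derivAtTop f * ((Measure.singularPart P Q Set.univ : ℝ≥0∞) : EReal)

/-- A pair of probability measures on an arbitrary measurable space. -/
structure PMPair where
  carrier : Type
  inst : MeasurableSpace carrier
  P : @Measure carrier inst
  Q : @Measure carrier inst
  probP : @IsProbabilityMeasure carrier inst P
  probQ : @IsProbabilityMeasure carrier inst Q

attribute [instance] PMPair.inst

/-- The total variation distance `V(P,Q) = (1/2) ∫ |p - q| dλ` (with `λ = P + Q`). -/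
def tvDist {Ω : Type*} [MeasurableSpace Ω] (P Q : Measure Ω) : ℝ :=
  (∫ x, |(Measure.rnDeriv P (P + Q) x).toReal - (Measure.rnDeriv Q (P + Q) x).toReal|
    ∂(P + Q)) / 2

/-- The function `ψ_{P,Q}(s) = ∫ min (p, q s) dλ` (with `λ = P + Q`). -/
def psiPQ {Ω : Type*} [MeasurableSpace Ω] (P Q : Measure Ω) (s : ℝ) : ℝ :=
  ∫ x, min ((Measure.rnDeriv P (P + Q) x).toReal)
    ((Measure.rnDeriv Q (P + Q) x).toReal * s) ∂(P + Q)

/-- The right derivative of `f`. -/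
def rightDeriv (f : ℝ → ℝ) (x : ℝ) : ℝ := derivWithin f (Set.Ioi x) x

/-- `ν` is the measure `ν_f` on `(0,∞)` with `ν (a,b] = ∂⁺f(b) - ∂⁺f(a)`. -/
def IsCurvatureMeasure (f : ℝ → ℝ) (ν : Measure ℝ) : Prop :=
  ∀ a b : ℝ, 0 < a → a ≤ b →
    ν (Set.Ioc a b) = ENNReal.ofReal (rightDeriv f b - rightDeriv f a)

/-- The functional `I_f(ψ) = ∫_{(0,∞)} (min(1,s) - ψ(s)) dν_f(s)`. -/
def Ifun (ν : Measure ℝ) (ψ : ℝ → ℝ) : ℝ≥0∞ :=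
  ∫⁻ s in Set.Ioi (0 : ℝ), ENNReal.ofReal (min 1 s - ψ s) ∂ν

/-- The class `C` of functions on `[0,∞)` (encoded as functions on `ℝ` vanishing on `(-∞,0)`)
that are nonnegative, concave, nondecreasing and bounded by `min(1,s)` on `[0,∞)`. -/
def Cclass : Set (ℝ → ℝ) :=
  {ψ | (∀ s, 0 ≤ s → 0 ≤ ψ s) ∧ ConcaveOn ℝ (Set.Ici 0) ψ ∧ MonotoneOn ψ (Set.Ici 0) ∧
    (∀ s, 0 ≤ s → ψ s ≤ min 1 s) ∧ ∀ s, s < 0 → ψ s = 0}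

/-! ### Auxiliary lemmas -/

theorem aux_sep {E : Type*} [NormedAddCommGroup E] [NormedSpace ℝ E] [FiniteDimensional ℝ E]
    {C : Set E} (hC : Convex ℝ C) (hne : C.Nonempty) (h0 : (0 : E) ∉ C) :
    ∃ l : E →L[ℝ] ℝ, l ≠ 0 ∧ ∀ x ∈ C, l x ≤ 0 := by
  by_cases hIntg : (interior C).Nonempty
  · obtain ⟨l, u, hl, h1, h2⟩ := geometric_hahn_banach_of_nonempty_interior hC
      (convex_singleton (0 : E))
      (by simpa using fun h => h0 (interior_subset h)) hIntg (by simp)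
    refine ⟨l, hl, fun x hx => (h1 x hx).trans ?_⟩
    simpa using h2 0 (by simp)
  · rw [hC.interior_nonempty_iff_affineSpan_eq_top] at hIntg
    have hlt : vectorSpan ℝ C < ⊤ := by
      rw [lt_top_iff_ne_top]
      intro h
      apply hIntg
      exact (AffineSubspace.affineSpan_eq_top_iff_vectorSpan_eq_top_of_nonempty ℝ E E hne).2 h
    obtain ⟨l, hl, hle⟩ := Submodule.exists_le_ker_of_lt_top _ hlt
    obtain ⟨c, hc⟩ := hne
    have hconst : ∀ x ∈ C, l x = l c := by
      intro x hx
      have := hle (vsub_mem_vectorSpan ℝ hx hc)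
      simp only [vsub_eq_sub, LinearMap.mem_ker, map_sub] at this
      linarith
    rcases le_total (l c) 0 with h | h
    · refine ⟨LinearMap.toContinuousLinearMap l, ?_, fun x hx => ?_⟩
      · simpa using hl
      · simpa [hconst x hx] using h
    · refine ⟨LinearMap.toContinuousLinearMap (-l), ?_, fun x hx => ?_⟩
      · simpa using hl
      · simpa [hconst x hx] using h

theorem aux_hull0 {Ω : Type*} [MeasurableSpace Ω] (μ : Measure Ω) [IsProbabilityMeasure μ] (n : ℕ) :
    ∀ (E : Type) [NormedAddCommGroup E] [NormedSpace ℝ E] [FiniteDimensional ℝ E],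
      Module.finrank ℝ E = n → ∀ (F : Ω → E) (s : Set E), Integrable F μ → ∫ x, F x ∂μ = 0 →
      (∀ᵐ x ∂μ, F x ∈ s) → (0 : E) ∈ convexHull ℝ s := by
  induction n with
  | zero =>
    intro E _ _ _ hE F s hF h0 hs
    have : Subsingleton E := Module.finrank_zero_iff.1 hE
    obtain ⟨x, hx⟩ := hs.exists
    rw [Subsingleton.elim 0 (F x)]
    exact subset_convexHull ℝ s hx
  | succ n ih =>
    intro E _ _ _ hE F s hF h0 hs
    by_contra hcon
    obtain ⟨x, hx⟩ := hs.exists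
    obtain ⟨l, hl, hle⟩ := aux_sep (convex_convexHull ℝ s) ⟨F x, subset_convexHull ℝ s hx⟩ hcon
    have hIntg : ∫ x, l (F x) ∂μ = 0 := by
      rw [l.integral_comp_comm hF, h0, map_zero]
    have hz : ∀ᵐ x ∂μ, l (F x) = 0 := by
      have h1 : ∫ x, - l (F x) ∂μ = 0 := by rw [integral_neg, hIntg, neg_zero]
      have h2 := (integral_eq_zero_iff_of_nonneg_ae (μ := μ) (f := fun x => - l (F x)) (by
        filter_upwards [hs] with x hx
        simpa using hle _ (subset_convexHull ℝ s hx)) (l.integrable_comp hF).neg).1 h1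
      filter_upwards [h2] with x hx
      simpa using hx
    let K : Submodule ℝ E := LinearMap.ker (l : E →ₗ[ℝ] ℝ)
    have hK : Module.finrank ℝ K = n := by
      have h1 := Module.Dual.finrank_ker_add_one_of_ne_zero (f := (l : E →ₗ[ℝ] ℝ)) (by
        intro h; apply hl; ext y; simpa using congrArg (fun g => g y) h)
      rw [hE] at h1
      exact Nat.succ_injective h1
    obtain ⟨pr, hpr⟩ := Submodule.exists_isCompl K
    let π : E →L[ℝ] K := LinearMap.toContinuousLinearMap (K.projectionOnto pr hpr)
    have hπ : ∀ y : K, π y = y := fun y => by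
      simp [π]
    have := ih K hK (fun x => π (F x)) (Subtype.val ⁻¹' s) (π.integrable_comp hF)
      (by rw [π.integral_comp_comm hF, h0, map_zero]) (by
        filter_upwards [hs, hz] with x hx hx0
        have : π (F x) = (⟨F x, hx0⟩ : K) := hπ ⟨F x, hx0⟩
        rw [this]; exact hx)
    apply hcon
    have h3 : K.subtype 0 ∈ K.subtype '' (convexHull ℝ (Subtype.val ⁻¹' s)) := ⟨0, this, rfl⟩
    rw [LinearMap.image_convexHull] at h3
    rw [map_zero] at h3
    refine convexHull_mono ?_ h3
    rintro _ ⟨y, hy, rfl⟩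
    exact hy

theorem aux_hull {Ω : Type*} [MeasurableSpace Ω] (Q : Measure Ω) [IsProbabilityMeasure Q]
    {κ : Type} [Fintype κ] (G : κ → ℝ → ℝ) (p : Ω → ℝ) (X : Set ℝ)
    (hG : ∀ k, Integrable (fun x => G k (p x)) Q) (hX : ∀ᵐ x ∂Q, p x ∈ X) :
    ∃ (ι : Type) (_ : Fintype ι) (w : ι → ℝ) (x : ι → ℝ), (∀ i, 0 ≤ w i) ∧ ∑ i, w i = 1 ∧
      (∀ i, x i ∈ X) ∧ ∀ k, ∑ i, w i * G k (x i) = ∫ ω, G k (p ω) ∂Q := by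
  have key := aux_hull0 Q _ (κ → ℝ) rfl (fun ω k => G k (p ω) - ∫ ω, G k (p ω) ∂Q)
    ((fun x k => G k x - ∫ ω, G k (p ω) ∂Q) '' X)
    (Integrable.of_eval fun k => (hG k).sub (integrable_const _))
    (by
      ext k
      rw [eval_integral (f := fun ω k => G k (p ω) - ∫ ω, G k (p ω) ∂Q)
        (fun k => (hG k).sub (integrable_const _))]
      rw [integral_sub (hG k) (integrable_const _)]
      simp)
    (by filter_upwards [hX] with ω hω using ⟨_, hω, rfl⟩)
  obtain ⟨ι, hι, w, z, hw, hw1, hz, hs⟩ := mem_convexHull_iff_exists_fintype.1 key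
  choose x hx hxz using hz
  refine ⟨ι, hι, w, x, hw, hw1, hx, fun k => ?_⟩
  have := congrFun hs k
  simp only [Finset.sum_apply, Pi.smul_apply, ← hxz, smul_eq_mul, mul_sub,
    Finset.sum_sub_distrib, ← Finset.sum_mul, hw1, Pi.zero_apply, one_mul] at this
  linarith

theorem aux_lp {ι κ : Type} [Fintype ι] [Fintype κ] (u : ι → κ → ℝ) (c : ι → ℝ) (a : κ → ℝ)
    (ha : ∀ i, 0 < ∑ k, a k * u i k) (N : ℕ) :
    ∀ w : ι → ℝ, (∀ i, 0 ≤ w i) → (Finset.univ.filter fun i => w i ≠ 0).card ≤ N →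
    ∃ w' : ι → ℝ, (∀ i, 0 ≤ w' i) ∧ (∀ i, w i = 0 → w' i = 0) ∧
      (Finset.univ.filter fun i => w' i ≠ 0).card ≤ Fintype.card κ ∧
      (∀ k, ∑ i, w' i * u i k = ∑ i, w i * u i k) ∧ ∑ i, w i * c i ≤ ∑ i, w' i * c i := by
  induction N with
  | zero =>
    intro w hw hN
    exact ⟨w, hw, fun i h => h, hN.trans (Nat.zero_le _), fun k => rfl, le_rfl⟩
  | succ N ih =>
    intro w hw hN
    by_cases hcard : (Finset.univ.filter fun i => w i ≠ 0).card ≤ Fintype.card κ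
    · exact ⟨w, hw, fun i h => h, hcard, fun k => rfl, le_rfl⟩
    set S := Finset.univ.filter fun i => w i ≠ 0 with hS
    -- find a kernel vector
    obtain ⟨v, hvS, hvu, hvne, hvc⟩ : ∃ v : ι → ℝ, (∀ i, w i = 0 → v i = 0) ∧
        (∀ k, ∑ i, v i * u i k = 0) ∧ (∃ i, v i ≠ 0) ∧ 0 ≤ ∑ i, v i * c i := by
      have hnl : ¬ LinearIndependent ℝ (fun i : S => u i) := by
        intro h
        have := h.fintype_card_le_finrank
        rw [Module.finrank_fintype_fun_eq_card, Fintype.card_coe] at this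
        exact hcard this
      obtain ⟨g, hg, i0, hi0⟩ := Fintype.not_linearIndependent_iff.1 hnl
      let v : ι → ℝ := fun i => if h : i ∈ S then g ⟨i, h⟩ else 0
      have hv : ∀ i, w i = 0 → v i = 0 := by
        intro i hi
        have : i ∉ S := by simp [hS, hi]
        simp [v, this]
      have hvu : ∀ k, ∑ i, v i * u i k = 0 := by
        intro k
        have h1 := congrFun hg k
        simp only [Finset.sum_apply, Pi.smul_apply, smul_eq_mul, Pi.zero_apply] at h1
        rw [← h1]
        rw [← Finset.sum_subset (Finset.subset_univ S), ← Finset.sum_coe_sort S]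
        · apply Finset.sum_congr rfl
          intro i _
          simp [v]
        · intro i _ hi
          simp [v, hi]
      have hne : v i0 ≠ 0 := by simpa [v] using hi0
      rcases le_total 0 (∑ i, v i * c i) with h | h
      · exact ⟨v, hv, hvu, ⟨i0, hne⟩, h⟩
      · refine ⟨fun i => - v i, fun i hi => by simp [hv i hi], fun k => ?_, ⟨i0, by simpa using hne⟩,
          ?_⟩
        · simp [hvu k]
        · simpa using h
    -- negative coordinate
    obtain ⟨i1, hi1⟩ : ∃ i, v i < 0 := by
      by_contra! hcon
      obtain ⟨i, hi⟩ := hvne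
      have h1 : ∑ i, v i * ∑ k, a k * u i k = 0 := by
        simp_rw [Finset.mul_sum]
        rw [Finset.sum_comm]
        apply Finset.sum_eq_zero
        intro k _
        have : ∑ i, v i * (a k * u i k) = a k * ∑ i, v i * u i k := by
          rw [Finset.mul_sum]; exact Finset.sum_congr rfl fun i _ => by ring
        rw [this, hvu k, mul_zero]
      have h2 := (Finset.sum_eq_zero_iff_of_nonneg
        (fun i _ => mul_nonneg (hcon i) (ha i).le)).1 h1 i (Finset.mem_univ i)
      rcases mul_eq_zero.1 h2 with h | h
      · exact hi h
      · exact (ha i).ne' h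
    obtain ⟨j, hj, hjmin⟩ := Finset.exists_min_image (Finset.univ.filter fun i => v i < 0)
      (fun i => w i / (- v i)) ⟨i1, by simpa using hi1⟩
    have hvj : v j < 0 := by simpa using hj
    set τ := w j / (- v j) with hτ
    have hτ0 : 0 ≤ τ := div_nonneg (hw j) (by linarith)
    have hjS : w j ≠ 0 := fun h => by have := hvS j h; linarith
    obtain ⟨w', h1, h2, h3, h4, h5⟩ := ih (fun i => w i + τ * v i) (by
      intro i
      by_cases hi : v i < 0
      · have := hjmin i (by simpa using hi)
        rw [le_div_iff₀ (by linarith)] at this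
        linarith
      · exact add_nonneg (hw i) (mul_nonneg hτ0 (not_lt.1 hi))) (by
      have hsub : (Finset.univ.filter fun i => w i + τ * v i ≠ 0) ⊆ S.erase j := by
        intro i hi
        simp only [Finset.mem_filter, Finset.mem_univ, true_and] at hi
        rw [Finset.mem_erase]
        constructor
        · rintro rfl
          apply hi
          rw [hτ]
          field_simp [hvj.ne]
          ring
        · simp only [hS, Finset.mem_filter, Finset.mem_univ, true_and]
          intro h
          apply hi
          simp [h, hvS i h]
      have := Finset.card_le_card hsub
      rw [Finset.card_erase_of_mem (by simp [hS, hjS])] at this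
      omega)
    refine ⟨w', h1, fun i hi => h2 i (by simp [hi, hvS i hi]), h3, fun k => ?_, ?_⟩
    · rw [h4 k]
      simp only [add_mul, Finset.sum_add_distrib, mul_assoc, ← Finset.mul_sum, hvu k]
      simp
    · refine le_trans ?_ h5
      simp only [add_mul, Finset.sum_add_distrib, mul_assoc, ← Finset.mul_sum]
      have := mul_nonneg hτ0 hvc
      linarith

theorem aux_reindex {ι : Type} [Fintype ι] [Nonempty ι] (w : ι → ℝ) (n : ℕ) (hw : ∀ i, 0 ≤ w i)
    (hn : (Finset.univ.filter fun i => w i ≠ 0).card ≤ n) :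
    ∃ (σ : Fin n → ι) (v : Fin n → ℝ), (∀ k, 0 ≤ v k) ∧ (∀ k, v k ≠ 0 → w (σ k) ≠ 0) ∧
      ∀ h : ι → ℝ, ∑ k, v k * h (σ k) = ∑ i, w i * h i := by
  set S := Finset.univ.filter fun i => w i ≠ 0 with hS
  obtain ⟨e⟩ : Nonempty (S ↪ Fin n) := by
    apply Function.Embedding.nonempty_of_card_le
    simpa using hn
  let σ : Fin n → ι := Function.extend e (fun i => (i : ι)) (fun _ => Classical.arbitrary ι)
  let v : Fin n → ℝ := Function.extend e (fun i => w i) 0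
  have hσ : ∀ i, σ (e i) = i := fun i => e.injective.extend_apply _ _ i
  have hv : ∀ i, v (e i) = w i := fun i => e.injective.extend_apply _ _ i
  have hv0 : ∀ k, (¬ ∃ i, e i = k) → v k = 0 := fun k hk => Function.extend_apply' _ _ _ hk
  refine ⟨σ, v, fun k => ?_, fun k hk => ?_, fun h => ?_⟩
  · by_cases hk : ∃ i, e i = k
    · obtain ⟨i, rfl⟩ := hk
      rw [hv]; exact hw _
    · rw [hv0 k hk]
  · by_cases hk' : ∃ i, e i = k
    · obtain ⟨i, rfl⟩ := hk'
      rw [hσ]; rwa [hv] at hk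
    · exact absurd (hv0 k hk') hk
  · rw [← Finset.sum_subset (Finset.subset_univ S), ← Finset.sum_coe_sort S,
      ← Finset.sum_subset (Finset.subset_univ (Finset.univ.map e)), Finset.sum_map]
    · exact Finset.sum_congr rfl fun i _ => by rw [hσ, hv]
    · intro k _ hk
      rw [hv0 k (by simpa using hk), zero_mul]
    · intro i _ hi
      have : w i = 0 := by simpa [hS] using hi
      rw [this, zero_mul]

theorem er_mul {a : EReal} {s : ℝ} (ha : a ≠ ⊥) (h : s ≠ 0 → a ≠ ⊤) :
    a * (s : EReal) = ((a.toReal * s : ℝ) : EReal) := by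
  by_cases hs : s = 0
  · simp [hs]
  · rw [EReal.coe_mul, EReal.coe_toReal (h hs) ha]

theorem er_ne_bot {a : EReal} {s : ℝ} (ha : a ≠ ⊥) (hs : 0 ≤ s) : a * (s : EReal) ≠ ⊥ := by
  by_cases h : s ≠ 0 → a ≠ ⊤
  · rw [er_mul ha h]; exact EReal.coe_ne_bot _
  · push Not at h
    rw [h.2, EReal.top_mul_coe_of_pos (lt_of_le_of_ne hs h.1.symm)]
    simp

theorem er_con {J a b : EReal} {s t D : ℝ} (hJ : J ≠ ⊥) (ha : a ≠ ⊥) (hb : b ≠ ⊥) (hs : 0 ≤ s)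
    (ht : 0 ≤ t) (h : J + a * (s : EReal) + b * (t : EReal) ≤ (D : EReal)) :
    J ≠ ⊤ ∧ (s ≠ 0 → a ≠ ⊤) ∧ (t ≠ 0 → b ≠ ⊤) := by
  have h1 := er_ne_bot ha hs
  have h2 := er_ne_bot hb ht
  refine ⟨?_, ?_, ?_⟩
  · rintro rfl
    rw [EReal.top_add_of_ne_bot h1, EReal.top_add_of_ne_bot h2] at h
    exact absurd h (by simp)
  · rintro hs0 rfl
    rw [EReal.top_mul_coe_of_pos (lt_of_le_of_ne hs hs0.symm), EReal.add_top_of_ne_bot hJ,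
      EReal.top_add_of_ne_bot h2] at h
    exact absurd h (by simp)
  · rintro ht0 rfl
    rw [EReal.top_mul_coe_of_pos (lt_of_le_of_ne ht ht0.symm), EReal.add_top_of_ne_bot] at h
    · exact absurd h (by simp)
    · simp [EReal.add_eq_bot_iff, hJ, h1]

theorem er_obj {a b : EReal} {x s t M : ℝ} (ha : a ≠ ⊥) (hb : b ≠ ⊥)
    (h : (M : EReal) < (x : EReal) + a * (s : EReal) + b * (t : EReal)) :
    ∃ A B : ℝ, (A : EReal) ≤ a ∧ (B : EReal) ≤ b ∧ M < x + A * s + B * t := by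
  by_cases h1 : s ≠ 0 → a ≠ ⊤
  · by_cases h2 : t ≠ 0 → b ≠ ⊤
    · refine ⟨a.toReal, b.toReal, EReal.coe_toReal_le ha, EReal.coe_toReal_le hb, ?_⟩
      rw [er_mul ha h1, er_mul hb h2] at h
      exact_mod_cast h
    · push Not at h2
      refine ⟨a.toReal, (M - x - a.toReal * s + 1) / t, EReal.coe_toReal_le ha, by simp [h2.2], ?_⟩
      rw [div_mul_cancel₀ _ h2.1]
      linarith
  · push Not at h1
    refine ⟨(M - x - b.toReal * t + 1) / s, b.toReal, by simp [h1.2], EReal.coe_toReal_le hb, ?_⟩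
    rw [div_mul_cancel₀ _ h1.1]
    linarith

theorem er_lower {a b : EReal} {x x' s t A B : ℝ} (hs : 0 ≤ s) (ht : 0 ≤ t)
    (hA : (A : EReal) ≤ a) (hB : (B : EReal) ≤ b) (hx : x' ≤ x) :
    ((x' + A * s + B * t : ℝ) : EReal) ≤ (x : EReal) + a * (s : EReal) + b * (t : EReal) := by
  push_cast
  refine add_le_add (add_le_add (by exact_mod_cast hx) ?_) ?_
  · exact mul_le_mul_of_nonneg_right hA (by exact_mod_cast hs)
  · exact mul_le_mul_of_nonneg_right hB (by exact_mod_cast ht)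

theorem aux_affine {f : ℝ → ℝ} (hf : ConvexOn ℝ (Set.Ioi 0) f) (hf1 : f 1 = 0) :
    ∃ c : ℝ, ∀ x, 0 < x → c * (x - 1) ≤ f x := by
  have h1 : (1 : ℝ) ∈ interior (Set.Ioi (0 : ℝ)) := by simp
  refine ⟨derivWithin f (Set.Ioi 1) 1, fun x hx => ?_⟩
  rcases lt_trichotomy 1 x with h | h | h
  · have := hf.rightDeriv_le_slope_of_mem_interior h1 hx h
    rw [slope_def_field, le_div_iff₀ (by linarith), hf1] at this
    linarith
  · simp [← h, hf1]
  · have h2 := hf.slope_le_leftDeriv_of_mem_interior hx h1 h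
    have h3 := h2.trans (hf.leftDeriv_le_rightDeriv_of_mem_interior h1)
    rw [slope_def_field, div_le_iff₀ (by linarith), hf1] at h3
    linarith

theorem aux_zero_ne_bot {f : ℝ → ℝ} (hf : ConvexOn ℝ (Set.Ioi 0) f) (hf1 : f 1 = 0) :
    limAtZero f ≠ ⊥ := by
  obtain ⟨c, hc⟩ := aux_affine hf hf1
  have : ((-|c| : ℝ) : EReal) ≤ limAtZero f := by
    apply le_limsup_of_frequently_le'
    apply Eventually.frequently
    filter_upwards [Ioo_mem_nhdsGT (show (0 : ℝ) < 1 by norm_num)] with x hx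
    have h1 := hc x hx.1
    have : -|c| ≤ f x := by
      cases abs_cases c <;> nlinarith [hx.1, hx.2]
    exact_mod_cast this
  exact ne_bot_of_le_ne_bot (EReal.coe_ne_bot _) this

theorem aux_top_ne_bot {f : ℝ → ℝ} (hf : ConvexOn ℝ (Set.Ioi 0) f) (hf1 : f 1 = 0) :
    derivAtTop f ≠ ⊥ := by
  obtain ⟨c, hc⟩ := aux_affine hf hf1
  have : ((-|c| : ℝ) : EReal) ≤ derivAtTop f := by
    apply le_limsup_of_frequently_le'
    apply Eventually.frequently
    filter_upwards [eventually_gt_atTop 1] with x hx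
    have h1 := hc x (by linarith)
    have : -|c| ≤ f x / x := by
      rw [le_div_iff₀ (by linarith)]
      cases abs_cases c <;> nlinarith
    exact_mod_cast this
  exact ne_bot_of_le_ne_bot (EReal.coe_ne_bot _) this

theorem fDiv_eq (f : ℝ → ℝ) {Ω : Type*} [MeasurableSpace Ω] (P Q : Measure Ω) [IsFiniteMeasure P]
    [IsFiniteMeasure Q] : fDiv f P Q =
  (if Integrable (fun x => f ((Measure.rnDeriv P Q x).toReal))
      (Q.restrict {x | Measure.rnDeriv P Q x ≠ 0})
   then ((∫ x in {x | Measure.rnDeriv P Q x ≠ 0},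
       f ((Measure.rnDeriv P Q x).toReal) ∂Q : ℝ) : EReal)
   else (⊤ : EReal))
  + limAtZero f * ((Q.real {x | Measure.rnDeriv P Q x = 0} : ℝ) : EReal)
  + derivAtTop f * (((Measure.singularPart P Q).real Set.univ : ℝ) : EReal) := by
  rw [fDiv, Measure.real, Measure.real, EReal.coe_ennreal_toReal (measure_ne_top _ _),
    EReal.coe_ennreal_toReal (measure_ne_top _ _)]

theorem fDiv_finite (f : ℝ → ℝ) {α : Type*} [Fintype α] [MeasurableSpace α]
    [MeasurableSingletonClass α] (P Q : Measure α) [IsFiniteMeasure P] [IsFiniteMeasure Q] :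
    fDiv f P Q =
      ((∑ k, (if Q.real {k} ≠ 0 ∧ P.real {k} ≠ 0 then
        Q.real {k} * f (P.real {k} / Q.real {k}) else 0) : ℝ) : EReal)
      + limAtZero f * ((∑ k, (if P.real {k} = 0 then Q.real {k} else 0) : ℝ) : EReal)
      + derivAtTop f * ((∑ k, (if Q.real {k} = 0 then P.real {k} else 0) : ℝ) : EReal) := by
  have hdec : ∀ k, P.real {k} = (P.singularPart Q).real {k} + (P.rnDeriv Q k).toReal * Q.real {k}
      := by
    intro k
    conv_lhs => rw [Measure.haveLebesgueDecomposition_add P Q]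
    rw [measureReal_add_apply, measureReal_def (μ := Q.withDensity _),
      withDensity_apply _ (measurableSet_singleton k), lintegral_singleton, ENNReal.toReal_mul]
    rfl
  have hsing : ∀ k, (P.singularPart Q).real {k} = if Q.real {k} = 0 then P.real {k} else 0 := by
    intro k
    split_ifs with h
    · rw [hdec k, h]; simp
    · obtain ⟨s, hs, h1, h2⟩ := Measure.mutuallySingular_singularPart P Q
      by_cases hk : k ∈ s
      · exact (measureReal_mono_null (by simpa using hk) (by simp [measureReal_def, h1]))
      · exfalso
        apply h
        exact (measureReal_mono_null (s₂ := sᶜ) (by simpa using hk) (by simp [measureReal_def, h2]))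
  have hrn : ∀ k, Q.real {k} ≠ 0 → (P.rnDeriv Q k).toReal = P.real {k} / Q.real {k} := by
    intro k hk
    have := hdec k
    rw [hsing, if_neg hk] at this
    rw [this]
    field_simp
    simp
  have hfin : ∀ k, Q.real {k} ≠ 0 → P.rnDeriv Q k ≠ ⊤ := by
    intro k hk h
    have h1 := Measure.rnDeriv_lt_top P Q
    apply hk
    rw [ae_iff] at h1
    exact measureReal_mono_null (s₂ := {a | ¬ P.rnDeriv Q a < ⊤}) (by simp [h])
      (by rw [measureReal_def, h1]; rfl)
  have hrn0 : ∀ k, Q.real {k} ≠ 0 → (P.rnDeriv Q k = 0 ↔ P.real {k} = 0) := by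
    intro k hk
    have h1 : (P.rnDeriv Q k).toReal = 0 ↔ P.rnDeriv Q k = 0 := by
      simp [ENNReal.toReal_eq_zero_iff, hfin k hk]
    rw [← h1, hrn k hk, div_eq_zero_iff]
    simp [hk]
  rw [fDiv_eq, if_pos (Integrable.of_finite)]
  congr 2
  · congr 1
    rw [← integral_indicator (Set.toFinite _).measurableSet, integral_fintype Integrable.of_finite]
    apply Finset.sum_congr rfl
    intro k _
    by_cases hk : Q.real {k} = 0
    · simp [hk]
    · by_cases hp : P.real {k} = 0
      · simp [hp, (hrn0 k hk).2 hp]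
      · have : P.rnDeriv Q k ≠ 0 := fun h => hp ((hrn0 k hk).1 h)
        simp [hk, hp, this, Set.indicator, hrn k hk]
  · congr 2
    rw [← setIntegral_one_eq_measureReal,
      ← integral_indicator (Set.toFinite _).measurableSet, integral_fintype Integrable.of_finite]
    apply Finset.sum_congr rfl
    intro k _
    by_cases hk : Q.real {k} = 0
    · simp [hk]
    · simp [Set.indicator, hrn0 k hk]
  · congr 2
    rw [← setIntegral_one_eq_measureReal, setIntegral_univ, integral_fintype Integrable.of_finite]
    apply Finset.sum_congr rfl
    intro k _
    simp [hsing k]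

/-- first coordinate of a point of `[0,∞]`. -/
def ptP : Option ℝ → ℝ
  | none => 1
  | some x => x

/-- second coordinate of a point of `[0,∞]`. -/
def ptQ : Option ℝ → ℝ
  | none => 0
  | some _ => 1

/-- the regular part. -/
def ptF (f : ℝ → ℝ) : Option ℝ → ℝ
  | none => 0
  | some x => if x = 0 then 0 else f x

/-- indicator of zero. -/
def ptZ : Option ℝ → ℝ
  | none => 0
  | some x => if x = 0 then 1 else 0

/-- indicator of infinity. -/
def ptT : Option ℝ → ℝ
  | none => 1
  | some _ => 0

/-- extension of `f` to `[0,∞]` with values `A` at zero and `B` at infinity. -/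
def ptH (f : ℝ → ℝ) (A B : ℝ) (o : Option ℝ) : ℝ := ptF f o + A * ptZ o + B * ptT o

theorem aux_build {n : ℕ} (v : Fin n → ℝ) (hv : ∀ k, 0 ≤ v k) (y : Fin n → Option ℝ)
    (hy : ∀ k x, y k = some x → 0 ≤ x) (hP : ∑ k, v k * ptP (y k) = 1)
    (hQ : ∑ k, v k * ptQ (y k) = 1) :
    ∃ P Q : Measure (Fin n), IsProbabilityMeasure P ∧ IsProbabilityMeasure Q ∧
      ∀ f : ℝ → ℝ, fDiv f P Q = ((∑ k, v k * ptF f (y k) : ℝ) : EReal)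
        + limAtZero f * ((∑ k, v k * ptZ (y k) : ℝ) : EReal)
        + derivAtTop f * ((∑ k, v k * ptT (y k) : ℝ) : EReal) := by
  have mk : ∀ g : Fin n → ℝ, (∀ k, 0 ≤ g k) → ∑ k, g k = 1 → ∃ R : Measure (Fin n),
      IsProbabilityMeasure R ∧ ∀ k, R.real {k} = g k := by
    intro g hg hg1
    have hval : ∀ s : Set (Fin n), (∑ k, ENNReal.ofReal (g k) • Measure.dirac k) s =
        ∑ k, ENNReal.ofReal (g k) * s.indicator 1 k := by
      intro s
      simp [Measure.finsetSum_apply, Measure.dirac_apply' _ (Set.toFinite s).measurableSet]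
    refine ⟨∑ k, ENNReal.ofReal (g k) • Measure.dirac k, ⟨?_⟩, fun k => ?_⟩
    · rw [hval]
      simp [← ENNReal.ofReal_sum_of_nonneg fun k _ => hg k, hg1]
    · rw [measureReal_def, hval, Finset.sum_eq_single k]
      · simp [hg k]
      · intro j _ hj
        simp [hj]
      · simp
  have hp0 : ∀ k, 0 ≤ ptP (y k) := by
    intro k
    cases h : y k with
    | none => simp [ptP]
    | some x => simpa [ptP] using hy k x h
  have hq0 : ∀ k, 0 ≤ ptQ (y k) := by
    intro k
    cases h : y k <;> simp [ptQ]
  obtain ⟨P, hPp, hPv⟩ := mk _ (fun k => mul_nonneg (hv k) (hp0 k)) hP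
  obtain ⟨Q, hQp, hQv⟩ := mk _ (fun k => mul_nonneg (hv k) (hq0 k)) hQ
  refine ⟨P, Q, hPp, hQp, fun f => ?_⟩
  rw [fDiv_finite]
  congr 2
  · congr 1
    apply Finset.sum_congr rfl
    intro k _
    rw [hPv, hQv]
    by_cases hk : v k = 0
    · simp [hk]
    · cases h : y k with
      | none => simp [ptQ, ptF]
      | some x =>
        by_cases hx : x = 0
        · simp [hx, ptP, ptF]
        · simp [ptQ, ptP, ptF, hk, hx]
  · congr 2
    apply Finset.sum_congr rfl
    intro k _
    rw [hPv, hQv]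
    by_cases hk : v k = 0
    · simp [hk]
    · cases h : y k with
      | none => simp [ptQ, ptZ]
      | some x =>
        by_cases hx : x = 0
        · simp [hx, ptP, ptQ, ptZ]
        · simp [ptP, ptZ, hk, hx]
  · congr 2
    ext k
    rw [hPv, hQv]
    by_cases hk : v k = 0
    · simp [hk]
    · cases h : y k with
      | none => simp [ptQ, ptP, ptT]
      | some x => simp [ptQ, ptT, hk]

theorem aux_unbdd {Ω : Type*} [MeasurableSpace Ω] (μ : Measure Ω) [IsFiniteMeasure μ]
    (g l : Ω → ℝ) (hg : AEStronglyMeasurable g μ) (hl : Integrable l μ) (hlg : ∀ᵐ x ∂μ, l x ≤ g x)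
    (hni : ¬ Integrable g μ) (C : ℝ) :
    ∃ K : ℝ, Integrable (fun x => min (g x) K) μ ∧ C < ∫ x, min (g x) K ∂μ := by
  by_contra! hcon
  have hIntg : ∀ n : ℕ, Integrable (fun x => min (g x) (n : ℝ)) μ := by
    intro n
    refine Integrable.mono' (hl.abs.add (integrable_const (n : ℝ)))
      (hg.inf aestronglyMeasurable_const) ?_
    filter_upwards [hlg] with x hx
    rw [Real.norm_eq_abs, abs_le]
    have hn : (0 : ℝ) ≤ n := Nat.cast_nonneg n
    constructor
    · apply le_min
      · have := neg_abs_le (l x); simp only [Pi.add_apply]; linarith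
      · have := abs_nonneg (l x); simp only [Pi.add_apply]; linarith
    · refine (min_le_right _ _).trans ?_
      have := abs_nonneg (l x); simp only [Pi.add_apply]; linarith
  apply hni
  have hgl : Integrable (fun x => g x + |l x|) μ := by
    refine ⟨hg.add hl.1.norm, ?_⟩
    have hae : ∀ᵐ x ∂μ, Tendsto (fun n : ℕ => ‖min (g x) (n : ℝ) + |l x|‖ₑ) atTop
        (nhds ‖g x + |l x|‖ₑ) := by
      filter_upwards with x
      apply Tendsto.congr' (f₁ := fun _ => ‖g x + |l x|‖ₑ) _ tendsto_const_nhds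
      filter_upwards [eventually_ge_atTop ⌈g x⌉₊] with n hn
      rw [min_eq_left]
      exact (Nat.le_ceil _).trans (by exact_mod_cast hn)
    have h1 : ∫⁻ x, ‖g x + |l x|‖ₑ ∂μ ≤
        liminf (fun n : ℕ => ∫⁻ x, ‖min (g x) (n : ℝ) + |l x|‖ₑ ∂μ) atTop := by
      rw [lintegral_congr_ae (g := fun x => liminf (fun n : ℕ => ‖min (g x) (n : ℝ) + |l x|‖ₑ) atTop)
        (by filter_upwards [hae] with x hx using hx.liminf_eq.symm)]
      exact lintegral_liminf_le' fun n => ((hIntg n).add hl.abs).1.enorm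
    refine lt_of_le_of_lt h1 ?_
    have h2 : ∀ n : ℕ, ∫⁻ x, ‖min (g x) (n : ℝ) + |l x|‖ₑ ∂μ ≤
        ENNReal.ofReal (C + ∫ x, |l x| ∂μ) := by
      intro n
      have h3 : 0 ≤ᵐ[μ] fun x => min (g x) (n : ℝ) + |l x| := by
        filter_upwards [hlg] with x hx
        have hn : (0 : ℝ) ≤ n := Nat.cast_nonneg n
        have h4 : - |l x| ≤ min (g x) (n : ℝ) := by
          apply le_min
          · have := neg_abs_le (l x); linarith
          · have := abs_nonneg (l x); linarith
        simp only [Pi.zero_apply]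
        linarith
      have h5 := ofReal_integral_eq_lintegral_ofReal ((hIntg n).add hl.abs) h3
      rw [lintegral_congr_ae (g := fun x => ENNReal.ofReal (min (g x) (n : ℝ) + |l x|))
        (by filter_upwards [h3] with x hx using Real.enorm_of_nonneg hx)]
      refine h5.symm.le.trans (ENNReal.ofReal_le_ofReal ?_)
      have h6 := integral_add (hIntg n) hl.abs
      have h7 := hcon n (hIntg n)
      simp only [Pi.add_apply] at h6 ⊢
      rw [h6]
      linarith
    refine lt_of_le_of_lt (liminf_le_liminf (Eventually.of_forall h2)) ?_
    simp
  refine (hgl.sub hl.abs).congr (Eventually.of_forall fun x => ?_)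
  simp

section general

variable {Ω : Type*} [MeasurableSpace Ω] (P Q : Measure Ω) [IsProbabilityMeasure P]
  [IsProbabilityMeasure Q]

theorem aux_measE : MeasurableSet {x | P.rnDeriv Q x ≠ 0} :=
  (Measure.measurable_rnDeriv P Q) (measurableSet_singleton 0).compl

theorem aux_pos : ∀ᵐ x ∂(Q.restrict {x | P.rnDeriv Q x ≠ 0}), 0 < (P.rnDeriv Q x).toReal := by
  filter_upwards [ae_restrict_mem (aux_measE P Q), ae_restrict_of_ae (Measure.rnDeriv_lt_top P Q)]
    with x hx hx'
  exact ENNReal.toReal_pos hx hx'.ne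

theorem aux_aesm {f : ℝ → ℝ} (hf : ConvexOn ℝ (Set.Ioi 0) f) :
    AEStronglyMeasurable (fun x => f ((P.rnDeriv Q x).toReal))
      (Q.restrict {x | P.rnDeriv Q x ≠ 0}) := by
  have hm : Measurable ((Set.Ioi (0 : ℝ)).piecewise f 0) :=
    ContinuousOn.measurable_piecewise (hf.continuousOn isOpen_Ioi) continuousOn_const
      measurableSet_Ioi
  have h2 : Measurable fun x => (Set.Ioi (0 : ℝ)).piecewise f 0 ((P.rnDeriv Q x).toReal) :=
    hm.comp (Measure.measurable_rnDeriv P Q).ennreal_toReal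
  refine h2.aestronglyMeasurable.congr ?_
  filter_upwards [aux_pos P Q] with x hx
  simp [Set.piecewise, hx]

theorem gen_constraint {f : ℝ → ℝ} (hf : ConvexOn ℝ (Set.Ioi 0) f) (hf1 : f 1 = 0) {D : ℝ}
    (h : fDiv f P Q ≤ (D : EReal)) :
    Integrable (fun x => f ((P.rnDeriv Q x).toReal)) (Q.restrict {x | P.rnDeriv Q x ≠ 0}) ∧
    (Q.real {x | P.rnDeriv Q x = 0} ≠ 0 → limAtZero f ≠ ⊤) ∧
    ((P.singularPart Q).real Set.univ ≠ 0 → derivAtTop f ≠ ⊤) ∧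
    ∫ x in {x | P.rnDeriv Q x ≠ 0}, f ((P.rnDeriv Q x).toReal) ∂Q +
      (limAtZero f).toReal * Q.real {x | P.rnDeriv Q x = 0} +
      (derivAtTop f).toReal * (P.singularPart Q).real Set.univ ≤ D := by
  have ha := aux_zero_ne_bot hf hf1
  have hb := aux_top_ne_bot hf hf1
  rw [fDiv_eq] at h
  obtain ⟨h1, h2, h3⟩ := er_con (by split_ifs <;> simp) ha hb measureReal_nonneg
    measureReal_nonneg h
  have hi : Integrable (fun x => f ((P.rnDeriv Q x).toReal))
      (Q.restrict {x | P.rnDeriv Q x ≠ 0}) := by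
    by_contra hni
    rw [if_neg hni] at h1
    exact h1 rfl
  refine ⟨hi, h2, h3, ?_⟩
  rw [if_pos hi, er_mul ha h2, er_mul hb h3] at h
  exact_mod_cast h

theorem gen_objective {f : ℝ → ℝ} (hf : ConvexOn ℝ (Set.Ioi 0) f) (hf1 : f 1 = 0) {M : ℝ}
    (h : (M : EReal) < fDiv f P Q) :
    ∃ (φ : ℝ → ℝ) (A B : ℝ), (∀ x, φ x ≤ f x) ∧ (A : EReal) ≤ limAtZero f ∧
    (B : EReal) ≤ derivAtTop f ∧
    Integrable (fun x => φ ((P.rnDeriv Q x).toReal)) (Q.restrict {x | P.rnDeriv Q x ≠ 0}) ∧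
    M < ∫ x in {x | P.rnDeriv Q x ≠ 0}, φ ((P.rnDeriv Q x).toReal) ∂Q +
      A * Q.real {x | P.rnDeriv Q x = 0} + B * (P.singularPart Q).real Set.univ := by
  have ha := aux_zero_ne_bot hf hf1
  have hb := aux_top_ne_bot hf hf1
  rw [fDiv_eq] at h
  by_cases hi : Integrable (fun x => f ((P.rnDeriv Q x).toReal))
      (Q.restrict {x | P.rnDeriv Q x ≠ 0})
  · rw [if_pos hi] at h
    obtain ⟨A, B, hA, hB, hM⟩ := er_obj ha hb h
    exact ⟨f, A, B, fun x => le_rfl, hA, hB, hi, hM⟩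
  · obtain ⟨c, hc⟩ := aux_affine hf hf1
    have hp : Integrable (fun x => (P.rnDeriv Q x).toReal) Q := Measure.integrable_toReal_rnDeriv
    obtain ⟨K, hK1, hK2⟩ := aux_unbdd (Q.restrict {x | P.rnDeriv Q x ≠ 0})
      (fun x => f ((P.rnDeriv Q x).toReal)) (fun x => c * ((P.rnDeriv Q x).toReal - 1))
      (aux_aesm P Q hf) ((hp.restrict.sub (integrable_const 1)).const_mul c)
      (by filter_upwards [aux_pos P Q] with x hx using hc _ hx) hi
      (M - (limAtZero f).toReal * Q.real {x | P.rnDeriv Q x = 0} -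
        (derivAtTop f).toReal * (P.singularPart Q).real Set.univ)
    refine ⟨fun x => min (f x) K, _, _, fun x => min_le_left _ _, EReal.coe_toReal_le ha,
      EReal.coe_toReal_le hb, hK1, ?_⟩
    linarith

theorem aux_H {φ : ℝ → ℝ} (A B : ℝ)
    (hi : Integrable (fun x => φ ((P.rnDeriv Q x).toReal))
      (Q.restrict {x | P.rnDeriv Q x ≠ 0})) :
    Integrable (fun x => ptH φ A B (some (P.rnDeriv Q x).toReal)) Q ∧
    ∫ x, ptH φ A B (some (P.rnDeriv Q x).toReal) ∂Q =
      ∫ x in {x | P.rnDeriv Q x ≠ 0}, φ ((P.rnDeriv Q x).toReal) ∂Q +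
      A * Q.real {x | P.rnDeriv Q x = 0} := by
  have hE := aux_measE P Q
  have hE0 : MeasurableSet {x | P.rnDeriv Q x = 0} :=
    (Measure.measurable_rnDeriv P Q) (measurableSet_singleton 0)
  have hae : (fun x => ptH φ A B (some (P.rnDeriv Q x).toReal)) =ᵐ[Q]
      (fun x => {x | P.rnDeriv Q x ≠ 0}.indicator (fun x => φ ((P.rnDeriv Q x).toReal)) x +
        {x | P.rnDeriv Q x = 0}.indicator (fun _ => A) x) := by
    filter_upwards [Measure.rnDeriv_lt_top P Q] with x hx
    by_cases h0 : P.rnDeriv Q x = 0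
    · simp [h0, ptH, ptF, ptZ, ptT]
    · have : (P.rnDeriv Q x).toReal ≠ 0 := ENNReal.toReal_ne_zero.2 ⟨h0, hx.ne⟩
      simp [h0, ptH, ptF, ptZ, ptT, if_neg this]
  have h1 := (integrable_indicator_iff hE).2 hi
  have h2 : Integrable ({x | P.rnDeriv Q x = 0}.indicator (fun _ => A)) Q :=
    (integrable_const A).indicator hE0
  refine ⟨(h1.add h2).congr hae.symm, ?_⟩
  rw [integral_congr_ae hae, integral_add h1 h2, integral_indicator hE,
    integral_indicator_const _ hE0, smul_eq_mul, mul_comm A]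

end general

theorem aux_core (m : ℕ) (f : ℝ → ℝ) (fs : Fin m → ℝ → ℝ)
    (hf : ConvexOn ℝ (Set.Ioi 0) f) (hf1 : f 1 = 0)
    (hfs : ∀ i, ConvexOn ℝ (Set.Ioi 0) (fs i)) (hfs1 : ∀ i, fs i 1 = 0)
    (D : Fin m → ℝ) {Ω : Type*} [MeasurableSpace Ω] (P Q : Measure Ω) [IsProbabilityMeasure P]
    [IsProbabilityMeasure Q] (hc : ∀ i, fDiv (fs i) P Q ≤ (D i : EReal)) (M : ℝ)
    (hM : (M : EReal) < fDiv f P Q) :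
    ∃ P' Q' : Measure (Fin (m + 2)),
        IsProbabilityMeasure P' ∧ IsProbabilityMeasure Q' ∧
        (∀ i, fDiv (fs i) P' Q' ≤ (D i : EReal)) ∧ (M : EReal) ≤ fDiv f P' Q' := by
  obtain ⟨φ, A, B, hφ, hA, hB, hφi, hφM⟩ := gen_objective P Q hf hf1 hM
  have hcon := fun i => gen_constraint P Q (hfs i) (hfs1 i) (hc i)
  set S := (P.singularPart Q).real Set.univ with hS
  set Q0 := Q.real {x | P.rnDeriv Q x = 0} with hQ0
  have hS0 : 0 ≤ S := measureReal_nonneg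
  -- discretize
  obtain ⟨ι, hι, w, x, hw, hw1, hx, hsum⟩ := aux_hull Q
    (κ := Option (Option (Fin m)))
    (fun k x => match k with
      | none => x
      | some none => ptH φ A B (some x)
      | some (some i) => ptH (fs i) (limAtZero (fs i)).toReal (derivAtTop (fs i)).toReal (some x))
    (fun ω => (P.rnDeriv Q ω).toReal) {x | 0 ≤ x ∧ (x = 0 → Q0 ≠ 0)}
    (by
      rintro (_ | _ | i)
      · exact Measure.integrable_toReal_rnDeriv
      · exact (aux_H P Q A B hφi).1
      · exact (aux_H P Q _ _ (hcon i).1).1)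
    (by
      by_cases h : Q0 = 0
      · have h' : Q {x | P.rnDeriv Q x = 0} = 0 := by
          rw [hQ0, measureReal_eq_zero_iff] at h
          exact h
        have h'' : ∀ᵐ x ∂Q, P.rnDeriv Q x ≠ 0 := by
          rw [ae_iff]; simpa using h'
        filter_upwards [h'', Measure.rnDeriv_lt_top P Q] with ω h1 h2
        refine ⟨ENNReal.toReal_nonneg, fun h3 => ?_⟩
        exact absurd h3 (ENNReal.toReal_ne_zero.2 ⟨h1, h2.ne⟩)
      · exact Eventually.of_forall fun ω => ⟨ENNReal.toReal_nonneg, fun _ => h⟩)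
  have hsp : ∑ i, w i * x i = 1 - S := by
    have h1 := hsum none
    simp only at h1
    rw [h1, Measure.integral_toReal_rnDeriv']
    simp [hS]
  have hsφ := hsum (some none)
  have hsi := fun i => hsum (some (some i))
  simp only at hsφ hsi
  rw [(aux_H P Q A B hφi).2] at hsφ
  simp only [fun i => (aux_H P Q (limAtZero (fs i)).toReal (derivAtTop (fs i)).toReal
    (hcon i).1).2] at hsi
  -- linear programming reduction
  let y : Option ι → Option ℝ := Option.map x
  let W : Option ι → ℝ := fun o => o.elim S w
  let u : Option ι → Option (Option (Fin m)) → ℝ := fun o k => match k with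
      | none => ptP (y o)
      | some none => ptQ (y o)
      | some (some i) => ptH (fs i) (limAtZero (fs i)).toReal (derivAtTop (fs i)).toReal (y o)
  let a : Option (Option (Fin m)) → ℝ := fun k => match k with
      | none => 1
      | some none => 1
      | some (some i) => 0
  have hW : ∀ o, 0 ≤ W o := by
    rintro (_ | i)
    · exact hS0
    · exact hw i
  obtain ⟨w', hw'0, hw'S, hw'c, hw'u, hw'o⟩ := aux_lp u (fun o => ptH φ A B (y o)) a
    (by
      rintro (_ | i)
      · simp [Fintype.sum_option, a, u, y, ptP, ptQ]
      · simp only [Fintype.sum_option, a, u, y, ptP, ptQ, Option.map_some]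
        have := (hx i).1
        simp only [one_mul, zero_mul, Finset.sum_const_zero, add_zero]
        linarith)
    _ W hW le_rfl
  have hcard : Fintype.card (Option (Option (Fin m))) = m + 2 := by simp
  rw [hcard] at hw'c
  obtain ⟨σ, v, hv0, hvw, hvs⟩ := aux_reindex w' (m + 2) hw'0 hw'c
  have htot : ∀ h : Option ℝ → ℝ, ∑ o, W o * h (y o) = S * h none + ∑ i, w i * h (some (x i)) := by
    intro h
    simp [Fintype.sum_option, W, y]
  obtain ⟨P', Q', hP', hQ', hdiv⟩ := aux_build v hv0 (fun k => y (σ k))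
    (by
      intro k t ht
      cases h : σ k with
      | none => simp [h, y] at ht
      | some i =>
        simp only [h, y, Option.map_some, Option.some.injEq] at ht
        rw [← ht]
        exact (hx i).1)
    (by
      rw [hvs (fun o => ptP (y o))]
      have := hw'u none
      simp only [u] at this
      rw [this, htot]
      simp only [ptP]
      rw [hsp]; ring)
    (by
      rw [hvs (fun o => ptQ (y o))]
      have := hw'u (some none)
      simp only [u] at this
      rw [this, htot]
      simp only [ptQ]
      simp [hw1])
  have hZ0 : 0 ≤ ∑ k, v k * ptZ (y (σ k)) := by
    refine Finset.sum_nonneg fun k _ => mul_nonneg (hv0 k) ?_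
    cases y (σ k) with
    | none => simp [ptZ]
    | some t => simp only [ptZ]; split_ifs <;> norm_num
  have hT0 : 0 ≤ ∑ k, v k * ptT (y (σ k)) := by
    refine Finset.sum_nonneg fun k _ => mul_nonneg (hv0 k) ?_
    cases y (σ k) with
    | none => simp [ptT]
    | some t => simp [ptT]
  have hZ : ∑ k, v k * ptZ (y (σ k)) ≠ 0 → Q0 ≠ 0 := by
    intro h
    obtain ⟨k, -, hk⟩ := Finset.exists_ne_zero_of_sum_ne_zero h
    cases h' : σ k with
    | none => simp [h', y, ptZ] at hk
    | some i =>
      apply (hx i).2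
      by_contra hne
      simp [h', y, ptZ, hne] at hk
  have hT : ∑ k, v k * ptT (y (σ k)) ≠ 0 → S ≠ 0 := by
    intro h
    obtain ⟨k, -, hk⟩ := Finset.exists_ne_zero_of_sum_ne_zero h
    cases h' : σ k with
    | some i => simp [h', y, ptT] at hk
    | none =>
      intro hS'
      have := hvw k (left_ne_zero_of_mul hk)
      rw [h'] at this
      exact this (hw'S none hS')
  have hsplit : ∀ (g : ℝ → ℝ) (a b : ℝ), ∑ k, v k * ptH g a b (y (σ k)) =
      ∑ k, v k * ptF g (y (σ k)) + a * ∑ k, v k * ptZ (y (σ k)) + b * ∑ k, v k * ptT (y (σ k)) := by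
    intro g a b
    rw [Finset.mul_sum, Finset.mul_sum, ← Finset.sum_add_distrib, ← Finset.sum_add_distrib]
    refine Finset.sum_congr rfl fun k _ => ?_
    rw [ptH]; ring
  refine ⟨P', Q', hP', hQ', fun i => ?_, ?_⟩
  · rw [hdiv, er_mul (aux_zero_ne_bot (hfs i) (hfs1 i)) (fun h => (hcon i).2.1 (hZ h)),
      er_mul (aux_top_ne_bot (hfs i) (hfs1 i)) (fun h => (hcon i).2.2.1 (hT h))]
    have h1 := hw'u (some (some i))
    simp only [u] at h1
    rw [← hvs (fun o => ptH (fs i) (limAtZero (fs i)).toReal (derivAtTop (fs i)).toReal (y o)),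
      htot, hsplit, hsi i] at h1
    have h2 := (hcon i).2.2.2
    have h3 : ptH (fs i) (limAtZero (fs i)).toReal (derivAtTop (fs i)).toReal none =
      (derivAtTop (fs i)).toReal := by simp [ptH, ptF, ptZ, ptT]
    rw [h3] at h1
    norm_cast
    linarith
  · rw [hdiv]
    have hle : ∑ k, v k * ptF φ (y (σ k)) ≤ ∑ k, v k * ptF f (y (σ k)) := by
      refine Finset.sum_le_sum fun k _ => mul_le_mul_of_nonneg_left ?_ (hv0 k)
      cases y (σ k) with
      | none => simp [ptF]
      | some t =>
        simp only [ptF]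
        split_ifs
        · exact le_rfl
        · exact hφ t
    refine le_trans ?_ (er_lower hZ0 hT0 hA hB hle)
    have h1 := hw'o
    rw [← hvs (fun o => ptH φ A B (y o)), htot, hsplit, hsφ] at h1
    have h3 : ptH φ A B none = B := by simp [ptH, ptF, ptZ, ptT]
    rw [h3] at h1
    norm_cast
    linarith

/-- **Theorem 1, first part (Guntuboyina–Saha–Schiebinger).**
The supremum of `D_f(P‖Q)` over all pairs of probability measures on all measurable spaces,
subject to `D_{f_i}(P‖Q) ≤ D_i` for `i = 1, …, m`, equals the same supremum restricted to
pairs of probability measures on a set with `m + 2` points. -/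
theorem sup_fDiv_reduction (m : ℕ) (f : ℝ → ℝ) (fs : Fin m → ℝ → ℝ)
    (hf : ConvexOn ℝ (Set.Ioi 0) f) (hf1 : f 1 = 0)
    (hfs : ∀ i, ConvexOn ℝ (Set.Ioi 0) (fs i)) (hfs1 : ∀ i, fs i 1 = 0)
    (D : Fin m → ℝ) (hD : ∀ i, 0 ≤ D i) :
    sSup {x : EReal | ∃ pp : PMPair,
        (∀ i, fDiv (fs i) pp.P pp.Q ≤ (D i : EReal)) ∧ x = fDiv f pp.P pp.Q} =
    sSup {x : EReal | ∃ P Q : Measure (Fin (m + 2)),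
        IsProbabilityMeasure P ∧ IsProbabilityMeasure Q ∧
        (∀ i, fDiv (fs i) P Q ≤ (D i : EReal)) ∧ x = fDiv f P Q} := by
  apply le_antisymm
  · apply sSup_le
    rintro _ ⟨pp, hc, rfl⟩
    rw [← EReal.ge_of_forall_gt_iff_ge]
    intro M hM
    have := pp.probP
    have := pp.probQ
    obtain ⟨P', Q', hP', hQ', h1, h2⟩ :=
      aux_core m f fs hf hf1 hfs hfs1 D pp.P pp.Q hc M hM
    exact h2.trans (le_sSup ⟨P', Q', hP', hQ', h1, rfl⟩)
  · apply sSup_le_sSup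
    rintro _ ⟨P, Q, hP, hQ, hc, rfl⟩
    exact ⟨⟨Fin (m + 2), inferInstance, P, Q, hP, hQ⟩, hc, rfl⟩

end
end

section
/- For every convex function f:(0,∞)→ℝ with f(1)=0 and every pair of probability measures P and Q on a measurable space, D_f(P‖Q) = I_f(ψ_{P,Q}), i.e. D_f(P‖Q) = ∫_0^∞ (min(1,s) − ψ_{P,Q}(s)) dν_f(s). -/
open MeasureTheory Filter Set
open scoped ENNReal NNReal Classical

noncomputable section

open Topology in
theorem tendsto_lintegral_mono_real {α : Type*} [MeasurableSpace α] (μ : Measure α)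
    (F : ℝ → α → ℝ≥0∞) (G : α → ℝ≥0∞) (hm : ∀ y, Measurable (F y))
    (hmono : ∀ s, Monotone fun y => F y s)
    (hG : ∀ᵐ s ∂μ, Tendsto (fun y => F y s) atTop (𝓝 (G s))) :
    Tendsto (fun y => ∫⁻ s, F y s ∂μ) atTop (𝓝 (∫⁻ s, G s ∂μ)) := by
  have h1 : Tendsto (fun n : ℕ => ∫⁻ s, F (n : ℝ) s ∂μ) atTop (𝓝 (∫⁻ s, G s ∂μ)) := by
    apply lintegral_tendsto_of_tendsto_of_monotone (fun n => (hm _).aemeasurable)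
    · exact Eventually.of_forall fun s i j hij => hmono s (by exact_mod_cast hij)
    · filter_upwards [hG] with s hs
      exact hs.comp tendsto_natCast_atTop_atTop
  have h2 : Monotone fun y => ∫⁻ s, F y s ∂μ := fun a b hab =>
    lintegral_mono fun s => hmono s hab
  have h3 := tendsto_atTop_iSup h2
  have h4 := h3.comp (tendsto_natCast_atTop_atTop (R := ℝ))
  rw [tendsto_nhds_unique h1 h4]
  exact h3

theorem rightDeriv_monoOn {f : ℝ → ℝ} (hf : ConvexOn ℝ (Set.Ioi 0) f) :
    MonotoneOn (rightDeriv f) (Set.Ioi 0) := by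
  have := hf.monotoneOn_rightDeriv
  rwa [interior_Ioi] at this

theorem rightDeriv_intervalIntegrable {f : ℝ → ℝ} (hf : ConvexOn ℝ (Set.Ioi 0) f) {a b : ℝ}
    (ha : 0 < a) (hab : a ≤ b) : IntervalIntegrable (rightDeriv f) volume a b := by
  apply MonotoneOn.intervalIntegrable
  rw [uIcc_of_le hab]
  exact (rightDeriv_monoOn hf).mono fun x hx => lt_of_lt_of_le ha hx.1

theorem rightDeriv_ftc {f : ℝ → ℝ} (hf : ConvexOn ℝ (Set.Ioi 0) f) {a b : ℝ}
    (ha : 0 < a) (hab : a ≤ b) : ∫ y in a..b, rightDeriv f y = f b - f a := by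
  apply intervalIntegral.integral_eq_sub_of_hasDeriv_right_of_le hab
  · exact (hf.continuousOn isOpen_Ioi).mono fun x hx => lt_of_lt_of_le ha hx.1
  · intro x hx
    exact hf.hasDerivWithinAt_rightDeriv_of_mem_interior
      (by rw [interior_Ioi]; exact lt_trans ha hx.1)
  · exact rightDeriv_intervalIntegrable hf ha hab

theorem curv_finite {f : ℝ → ℝ} {ν : Measure ℝ} (hν : IsCurvatureMeasure f ν) {a b : ℝ}
    (ha : 0 < a) : ν (Set.Ioc a b) < ⊤ := by
  rcases le_total a b with h | h
  · rw [hν a b ha h]; exact ENNReal.ofReal_lt_top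
  · simp [Set.Ioc_eq_empty_of_le h]

theorem taylor_right {f : ℝ → ℝ} (hf : ConvexOn ℝ (Set.Ioi 0) f)
    {ν : Measure ℝ} (hν : IsCurvatureMeasure f ν) {a x : ℝ} (ha : 0 < a) (hx : a ≤ x) :
    ∫⁻ s in Set.Ioc a x, ENNReal.ofReal (x - s) ∂ν
      = ENNReal.ofReal (f x - f a - rightDeriv f a * (x - a)) := by
  have : IsFiniteMeasure (ν.restrict (Set.Ioc a x)) :=
    ⟨by rw [Measure.restrict_apply_univ]; exact curv_finite hν ha⟩
  have e1 : ∀ s ∈ Set.Ioc a x, ENNReal.ofReal (x - s)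
      = ∫⁻ t in Set.Ioc a x, ({p : ℝ × ℝ | p.1 ≤ p.2}.indicator 1 (s, t) : ℝ≥0∞) := by
    intro s hs
    have : (fun t => ({p : ℝ × ℝ | p.1 ≤ p.2}.indicator 1 (s, t) : ℝ≥0∞))
        = (Set.Ici s).indicator 1 := by
      ext t; simp [Set.indicator]
    rw [this, lintegral_indicator_one measurableSet_Ici,
      Measure.restrict_apply measurableSet_Ici]
    have : Set.Ici s ∩ Set.Ioc a x = Set.Icc s x := by
      ext t; simp only [Set.mem_inter_iff, Set.mem_Ici, Set.mem_Ioc, Set.mem_Icc]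
      constructor
      · rintro ⟨h1, h2, h3⟩; exact ⟨h1, h3⟩
      · rintro ⟨h1, h2⟩; exact ⟨h1, lt_of_lt_of_le hs.1 h1, h2⟩
    rw [this, Real.volume_Icc]
  rw [setLIntegral_congr_fun measurableSet_Ioc e1, lintegral_lintegral_swap]
  · have e2 : ∀ t ∈ Set.Ioc a x,
        ∫⁻ s in Set.Ioc a x, ({p : ℝ × ℝ | p.1 ≤ p.2}.indicator 1 (s, t) : ℝ≥0∞) ∂ν
        = ENNReal.ofReal (rightDeriv f t - rightDeriv f a) := by
      intro t ht
      have : (fun s => ({p : ℝ × ℝ | p.1 ≤ p.2}.indicator 1 (s, t) : ℝ≥0∞))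
          = (Set.Iic t).indicator 1 := by
        ext s; simp [Set.indicator]
      rw [this, lintegral_indicator_one measurableSet_Iic,
        Measure.restrict_apply measurableSet_Iic, ← hν a t ha ht.1.le]
      congr 1
      ext s; simp only [Set.mem_inter_iff, Set.mem_Iic, Set.mem_Ioc]
      constructor
      · rintro ⟨h1, h2, h3⟩; exact ⟨h2, h1⟩
      · rintro ⟨h1, h2⟩; exact ⟨h2, h1, h2.trans ht.2⟩
    rw [setLIntegral_congr_fun measurableSet_Ioc e2]
    have hi := rightDeriv_intervalIntegrable hf ha hx
    have hi2 : IntervalIntegrable (fun t => rightDeriv f t - rightDeriv f a) volume a x :=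
      hi.sub intervalIntegrable_const
    rw [← ofReal_integral_eq_lintegral_ofReal]
    · rw [← intervalIntegral.integral_of_le hx,
        intervalIntegral.integral_sub hi intervalIntegrable_const, rightDeriv_ftc hf ha hx]
      simp; ring_nf
    · exact (intervalIntegrable_iff_integrableOn_Ioc_of_le hx).1 hi2
    · refine (ae_restrict_iff' measurableSet_Ioc).2 (Eventually.of_forall fun t ht => ?_)
      exact sub_nonneg.2 (rightDeriv_monoOn hf ha (lt_trans ha ht.1) ht.1.le)
  · exact ((measurable_one.indicator (measurableSet_le measurable_fst measurable_snd))).aemeasurable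

theorem taylor_left {f : ℝ → ℝ} (hf : ConvexOn ℝ (Set.Ioi 0) f)
    {ν : Measure ℝ} (hν : IsCurvatureMeasure f ν) {a x : ℝ} (ha : 0 < x) (hx : x ≤ a) :
    ∫⁻ s in Set.Ioc x a, ENNReal.ofReal (s - x) ∂ν
      = ENNReal.ofReal (f x - f a - rightDeriv f a * (x - a)) := by
  have : IsFiniteMeasure (ν.restrict (Set.Ioc x a)) :=
    ⟨by rw [Measure.restrict_apply_univ]; exact curv_finite hν ha⟩
  have e1 : ∀ s ∈ Set.Ioc x a, ENNReal.ofReal (s - x)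
      = ∫⁻ t in Set.Ioc x a, ({p : ℝ × ℝ | p.2 < p.1}.indicator 1 (s, t) : ℝ≥0∞) := by
    intro s hs
    have : (fun t => ({p : ℝ × ℝ | p.2 < p.1}.indicator 1 (s, t) : ℝ≥0∞))
        = (Set.Iio s).indicator 1 := by
      ext t; simp [Set.indicator]
    rw [this, lintegral_indicator_one measurableSet_Iio,
      Measure.restrict_apply measurableSet_Iio]
    have : Set.Iio s ∩ Set.Ioc x a = Set.Ioo x s := by
      ext t; simp only [Set.mem_inter_iff, Set.mem_Iio, Set.mem_Ioc, Set.mem_Ioo]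
      constructor
      · rintro ⟨h1, h2, h3⟩; exact ⟨h2, h1⟩
      · rintro ⟨h1, h2⟩; exact ⟨h2, h1, h2.le.trans hs.2⟩
    rw [this, Real.volume_Ioo]
  rw [setLIntegral_congr_fun measurableSet_Ioc e1, lintegral_lintegral_swap]
  · have e2 : ∀ t ∈ Set.Ioc x a,
        ∫⁻ s in Set.Ioc x a, ({p : ℝ × ℝ | p.2 < p.1}.indicator 1 (s, t) : ℝ≥0∞) ∂ν
        = ENNReal.ofReal (rightDeriv f a - rightDeriv f t) := by
      intro t ht
      have : (fun s => ({p : ℝ × ℝ | p.2 < p.1}.indicator 1 (s, t) : ℝ≥0∞))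
          = (Set.Ioi t).indicator 1 := by
        ext s; simp [Set.indicator]
      rw [this, lintegral_indicator_one measurableSet_Ioi,
        Measure.restrict_apply measurableSet_Ioi, ← hν t a (ha.trans ht.1) ht.2]
      congr 1
      ext s; simp only [Set.mem_inter_iff, Set.mem_Ioi, Set.mem_Ioc]
      constructor
      · rintro ⟨h1, h2, h3⟩; exact ⟨h1, h3⟩
      · rintro ⟨h1, h2⟩; exact ⟨h1, ht.1.trans h1, h2⟩
    rw [setLIntegral_congr_fun measurableSet_Ioc e2]
    have hi := rightDeriv_intervalIntegrable hf ha hx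
    have hi2 : IntervalIntegrable (fun t => rightDeriv f a - rightDeriv f t) volume x a :=
      intervalIntegrable_const.sub hi
    rw [← ofReal_integral_eq_lintegral_ofReal]
    · rw [← intervalIntegral.integral_of_le hx,
        intervalIntegral.integral_sub intervalIntegrable_const hi, rightDeriv_ftc hf ha hx]
      simp; ring_nf
    · exact (intervalIntegrable_iff_integrableOn_Ioc_of_le hx).1 hi2
    · refine (ae_restrict_iff' measurableSet_Ioc).2 (Eventually.of_forall fun t ht => ?_)
      exact sub_nonneg.2 (rightDeriv_monoOn hf (ha.trans ht.1) (lt_of_lt_of_le ha hx) ht.2)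
  · exact ((measurable_one.indicator (measurableSet_lt measurable_snd measurable_fst))).aemeasurable

/-- The Taylor kernel. -/
def kker (x s : ℝ) : ℝ := (if s ≤ 1 then s else x) - min x s

def Hfun (ν : Measure ℝ) (x : ℝ) : ℝ≥0∞ := ∫⁻ s in Set.Ioi (0 : ℝ), ENNReal.ofReal (kker x s) ∂ν

theorem measurable_kker : Measurable (fun p : ℝ × ℝ => kker p.1 p.2) := by
  unfold kker
  exact (Measurable.ite (measurableSet_le measurable_snd measurable_const) measurable_snd
    measurable_fst).sub (measurable_fst.min measurable_snd)

theorem kker_nonneg (x s : ℝ) : 0 ≤ kker x s := by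
  unfold kker; split_ifs <;> simp

theorem restrict_indicator_eq {ν : Measure ℝ} {S : Set ℝ} (hS : MeasurableSet S)
    (hS0 : S ⊆ Set.Ioi 0) (g h : ℝ → ℝ≥0∞) (h1 : ∀ s ∈ S, h s = g s)
    (h2 : ∀ s, 0 < s → s ∉ S → h s = 0) :
    ∫⁻ s in Set.Ioi (0 : ℝ), h s ∂ν = ∫⁻ s in S, g s ∂ν := by
  have : ∫⁻ s in S, g s ∂ν = ∫⁻ s in Set.Ioi (0 : ℝ), S.indicator g s ∂ν := by
    rw [lintegral_indicator hS, Measure.restrict_restrict hS, Set.inter_eq_left.2 hS0]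
  rw [this]
  apply setLIntegral_congr_fun measurableSet_Ioi
  intro s hs
  by_cases hs' : s ∈ S
  · simp [hs', h1 s hs']
  · simp [hs', h2 s hs hs']

theorem Hfun_eq {f : ℝ → ℝ} (hf : ConvexOn ℝ (Set.Ioi 0) f) (hf1 : f 1 = 0)
    {ν : Measure ℝ} (hν : IsCurvatureMeasure f ν) {x : ℝ} (hx : 0 < x) :
    Hfun ν x = ENNReal.ofReal (f x - rightDeriv f 1 * (x - 1)) := by
  unfold Hfun
  rcases le_total 1 x with h | h
  · have := taylor_right hf hν one_pos h
    rw [hf1, sub_zero] at this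
    rw [← this]
    apply restrict_indicator_eq measurableSet_Ioc
    · exact fun s hs => one_pos.trans hs.1
    · intro s hs
      simp [kker, not_le.2 hs.1, hs.2]
    · intro s hs hs'
      rw [ENNReal.ofReal_eq_zero]; unfold kker
      simp only [Set.mem_Ioc, not_and, not_le] at hs'
      split_ifs with h3
      · simp [h3.trans h]
      · simp [(hs' (not_le.1 h3)).le]
  · have := taylor_left hf hν hx h
    rw [hf1, sub_zero] at this
    rw [← this]
    apply restrict_indicator_eq measurableSet_Ioc
    · exact fun s hs => hx.trans hs.1
    · intro s hs
      simp [kker, hs.2, hs.1.le]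
    · intro s hs hs'
      rw [ENNReal.ofReal_eq_zero]; unfold kker
      simp only [Set.mem_Ioc, not_and, not_le] at hs'
      split_ifs with h3
      · have : s ≤ x := by by_contra h4; linarith [hs' (not_le.1 h4)]
        simp [this]
      · simp [h.trans (not_le.1 h3).le]

/-- convexity: f lies above its tangent at 1 -/
theorem tangent_le {f : ℝ → ℝ} (hf : ConvexOn ℝ (Set.Ioi 0) f) (hf1 : f 1 = 0)
    {x : ℝ} (hx : 0 < x) : 0 ≤ f x - rightDeriv f 1 * (x - 1) := by
  rcases le_total 1 x with h | h
  · have h1 := rightDeriv_ftc hf one_pos h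
    have : ∫ y in (1:ℝ)..x, rightDeriv f 1 ≤ ∫ y in (1:ℝ)..x, rightDeriv f y := by
      apply intervalIntegral.integral_mono_on h intervalIntegrable_const
        (rightDeriv_intervalIntegrable hf one_pos h)
      intro y hy
      exact rightDeriv_monoOn hf (by simp) (lt_of_lt_of_le one_pos hy.1) hy.1
    rw [h1, hf1] at this
    simp at this; nlinarith
  · have h1 := rightDeriv_ftc hf hx h
    have : ∫ y in x..(1:ℝ), rightDeriv f y ≤ ∫ y in x..(1:ℝ), rightDeriv f 1 := by
      apply intervalIntegral.integral_mono_on h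
        (rightDeriv_intervalIntegrable hf hx h) intervalIntegrable_const
      intro y hy
      exact rightDeriv_monoOn hf (lt_of_lt_of_le hx hy.1) (by simp) hy.2
    rw [h1, hf1] at this
    simp at this; nlinarith

theorem kker_zero (s : ℝ) (hs : 0 < s) : kker 0 s = if s ≤ 1 then s else 0 := by
  unfold kker; simp [hs.le]

theorem coe_Hfun {f : ℝ → ℝ} (hf : ConvexOn ℝ (Set.Ioi 0) f) (hf1 : f 1 = 0)
    {ν : Measure ℝ} (hν : IsCurvatureMeasure f ν) {x : ℝ} (hx : 0 < x) :
    ((Hfun ν x : ℝ≥0∞) : EReal) = ((f x - rightDeriv f 1 * (x - 1) : ℝ) : EReal) := by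
  rw [Hfun_eq hf hf1 hν hx, EReal.coe_ennreal_ofReal, max_eq_left (tangent_le hf hf1 hx)]

theorem tendsto_add_real {ι : Type*} {l : Filter ι} {u : ι → ℝ≥0∞} {v : ι → ℝ} {a : ℝ≥0∞} {b : ℝ}
    (hu : Tendsto u l (nhds a)) (hv : Tendsto v l (nhds b)) :
    Tendsto (fun i => ((u i : ℝ≥0∞) : EReal) + ((v i : ℝ) : EReal)) l
      (nhds ((a : EReal) + (b : EReal))) := by
  have h1 : Tendsto (fun i => ((u i : ℝ≥0∞) : EReal)) l (nhds (a : EReal)) :=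
    (continuous_coe_ennreal_ereal.tendsto a).comp hu
  have h2 : Tendsto (fun i => ((v i : ℝ) : EReal)) l (nhds (b : EReal)) :=
    (continuous_coe_real_ereal.tendsto b).comp hv
  exact (EReal.continuousAt_add (p := ((a : EReal), (b : EReal)))
    (Or.inr (by simp)) (Or.inr (by simp))).tendsto.comp (h1.prodMk_nhds h2)

open Topology in
theorem limAtZero_eq {f : ℝ → ℝ} (hf : ConvexOn ℝ (Set.Ioi 0) f) (hf1 : f 1 = 0)
    {ν : Measure ℝ} (hν : IsCurvatureMeasure f ν) :
    limAtZero f = (Hfun ν 0 : EReal) + ((- rightDeriv f 1 : ℝ) : EReal) := by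
  have key : Tendsto (fun x => Hfun ν x) (𝓝[>] 0) (𝓝 (Hfun ν 0)) := by
    have h := tendsto_lintegral_mono_real (ν.restrict (Set.Ioi 0))
      (fun y s => ENNReal.ofReal (if s ≤ 1 then s - (max y 1)⁻¹ else 0))
      (fun s => ENNReal.ofReal (kker 0 s)) ?_ ?_ ?_
    · refine (h.comp tendsto_inv_nhdsGT_zero).congr' ?_
      have : Set.Ioo (0:ℝ) 1 ∈ 𝓝[>] (0:ℝ) := Ioo_mem_nhdsGT one_pos
      filter_upwards [this] with x hx
      have hx1 : max x⁻¹ 1 = x⁻¹ := max_eq_left ((one_le_inv₀ hx.1).2 hx.2.le)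
      simp only [Function.comp, hx1, inv_inv]
      unfold Hfun
      apply setLIntegral_congr_fun measurableSet_Ioi
      intro s hs
      unfold kker
      dsimp only
      split_ifs with h3
      · rcases le_total x s with h4 | h4
        · simp [h4]
        · simp [h4]
      · rw [min_eq_left (hx.2.le.trans (not_le.1 h3).le)]; simp
    · intro y
      exact (Measurable.ite (measurableSet_le measurable_id measurable_const)
        (measurable_id.sub_const _) measurable_const).ennreal_ofReal
    · intro s a b hab
      dsimp only
      split_ifs with h3
      · apply ENNReal.ofReal_le_ofReal
        have := inv_anti₀ (lt_of_lt_of_le one_pos (le_max_right a 1)) (max_le_max_right 1 hab)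
        linarith
      · exact le_rfl
    · refine (ae_restrict_iff' measurableSet_Ioi).2 (Eventually.of_forall fun s hs => ?_)
      rw [kker_zero s hs]
      apply (ENNReal.continuous_ofReal.tendsto _).comp
      split_ifs with h3
      · have : Tendsto (fun y : ℝ => (max y 1)⁻¹) atTop (𝓝 0) :=
          tendsto_inv_atTop_zero.comp
            (tendsto_atTop_mono (fun y => le_max_left y 1) tendsto_id)
        simpa using this.const_sub s
      · exact tendsto_const_nhds
  have h2 : Tendsto (fun x : ℝ => rightDeriv f 1 * (x - 1)) (𝓝[>] 0) (𝓝 (- rightDeriv f 1)) := by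
    have : Continuous fun x : ℝ => rightDeriv f 1 * (x - 1) := by fun_prop
    have := (this.tendsto 0).mono_left (nhdsWithin_le_nhds (s := Set.Ioi 0))
    simpa using this
  unfold limAtZero
  apply Tendsto.limsup_eq
  refine (tendsto_add_real key h2).congr' ?_
  filter_upwards [self_mem_nhdsWithin] with x hx
  rw [coe_Hfun hf hf1 hν hx, ← EReal.coe_add]
  simp

open Topology in
theorem derivAtTop_eq {f : ℝ → ℝ} (hf : ConvexOn ℝ (Set.Ioi 0) f) (hf1 : f 1 = 0)
    {ν : Measure ℝ} (hν : IsCurvatureMeasure f ν) :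
    derivAtTop f = (ν (Set.Ioi 1) : EReal) + ((rightDeriv f 1 : ℝ) : EReal) := by
  have key : Tendsto (fun x => ENNReal.ofReal x⁻¹ * Hfun ν x) atTop (𝓝 (ν (Set.Ioi 1))) := by
    have h := tendsto_lintegral_mono_real (ν.restrict (Set.Ioi 1))
      (fun y s => ENNReal.ofReal (1 - |s| * (max y 1)⁻¹)) 1 ?_ ?_ ?_
    · simp only [Pi.one_apply, lintegral_one, Measure.restrict_apply_univ] at h
      refine h.congr' ?_
      filter_upwards [eventually_ge_atTop 1] with x hx
      have hx0 : (0:ℝ) < x := one_pos.trans_le hx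
      unfold Hfun
      rw [← lintegral_const_mul]
      · symm
        apply restrict_indicator_eq measurableSet_Ioi
        · exact fun s hs => lt_trans one_pos (Set.mem_Ioi.1 hs)
        · intro s hs
          rw [← ENNReal.ofReal_mul (by positivity)]
          have hs' : (1:ℝ) < s := hs
          rw [max_eq_left hx, abs_of_pos (one_pos.trans hs')]
          unfold kker
          rw [if_neg (not_le.2 hs')]
          rcases le_total x s with h4 | h4
          · rw [min_eq_left h4]
            symm; simp only [sub_self, mul_zero, ENNReal.ofReal_zero]
            rw [ENNReal.ofReal_eq_zero]
            have := mul_le_mul_of_nonneg_right h4 (inv_nonneg.2 hx0.le)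
            rw [mul_inv_cancel₀ hx0.ne'] at this
            linarith
          · rw [min_eq_right h4]
            congr 1; field_simp
        · intro s hs hs'
          have : s ≤ 1 := not_lt.1 hs'
          simp [kker, this, this.trans hx]
      · exact (measurable_kker.comp (measurable_const.prodMk measurable_id)).ennreal_ofReal
    · intro y; fun_prop
    · intro s a b hab
      apply ENNReal.ofReal_le_ofReal
      have := inv_anti₀ (lt_of_lt_of_le one_pos (le_max_right a 1)) (max_le_max_right 1 hab)
      have := mul_le_mul_of_nonneg_left this (abs_nonneg s)
      linarith
    · refine Eventually.of_forall fun s => ?_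
      have : Tendsto (fun y : ℝ => (max y 1)⁻¹) atTop (𝓝 0) :=
          tendsto_inv_atTop_zero.comp
            (tendsto_atTop_mono (fun y => le_max_left y 1) tendsto_id)
      have := (this.const_mul |s|).const_sub 1
      have := (ENNReal.continuous_ofReal.tendsto _).comp this
      simpa [Function.comp_def] using this
  have h2 : Tendsto (fun x : ℝ => rightDeriv f 1 * (1 - x⁻¹)) atTop (𝓝 (rightDeriv f 1)) := by
    have := (tendsto_inv_atTop_zero (𝕜 := ℝ)).const_sub 1 |>.const_mul (rightDeriv f 1)
    simpa using this
  unfold derivAtTop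
  apply Tendsto.limsup_eq
  refine (tendsto_add_real key h2).congr' ?_
  filter_upwards [eventually_gt_atTop 0] with x hx
  rw [EReal.coe_ennreal_mul, coe_Hfun hf hf1 hν hx, EReal.coe_ennreal_ofReal,
    max_eq_left (inv_nonneg.2 hx.le), ← EReal.coe_mul, ← EReal.coe_add]
  congr 1
  field_simp; ring

theorem curv_sigmaFinite {f : ℝ → ℝ} {ν : Measure ℝ} (hν : IsCurvatureMeasure f ν) :
    SigmaFinite (ν.restrict (Set.Ioi 0)) := by
  refine ⟨⟨⟨fun n : ℕ => Set.Iic 0 ∪ Set.Ioc (1 / ((n : ℝ) + 1)) n, fun _ => trivial, ?_, ?_⟩⟩⟩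
  · intro n
    rw [Measure.restrict_apply (measurableSet_Iic.union measurableSet_Ioc)]
    refine lt_of_le_of_lt (measure_mono ?_) (curv_finite hν (a := 1 / ((n : ℝ) + 1)) (b := n)
      (by positivity))
    rintro s ⟨h1 | h1, h2⟩
    · exact absurd (Set.mem_Ioi.1 h2) (not_lt.2 h1)
    · exact h1
  · rw [Set.eq_univ_iff_forall]
    intro s
    rw [Set.mem_iUnion]
    rcases le_or_gt s 0 with h | h
    · exact ⟨0, Or.inl h⟩
    · obtain ⟨n, hn⟩ := exists_nat_one_div_lt h
      obtain ⟨m, hm⟩ := exists_nat_ge s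
      refine ⟨max n m, Or.inr ⟨lt_of_le_of_lt ?_ hn, hm.trans (by exact_mod_cast le_max_right n m)⟩⟩
      apply one_div_le_one_div_of_le (by positivity)
      have : (n : ℝ) ≤ ((max n m : ℕ) : ℝ) := by exact_mod_cast le_max_left n m
      linarith

theorem psi_eq {Ω : Type*} [MeasurableSpace Ω] (P Q : Measure Ω)
    [IsProbabilityMeasure P] [IsProbabilityMeasure Q] (s : ℝ) (hs : 0 < s) :
    psiPQ P Q s = ∫ x, min (P.rnDeriv Q x).toReal s ∂Q := by
  have hQ : Q ≪ P + Q := Measure.absolutelyContinuous_of_le (Measure.le_add_left le_rfl)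
  rw [← integral_rnDeriv_smul hQ]
  unfold psiPQ
  apply integral_congr_ae
  have hms := Measure.mutuallySingular_singularPart P Q
  have hfin : IsFiniteMeasure (Q.withDensity (P.rnDeriv Q)) := inferInstance
  have e1 : P.rnDeriv (P + Q) =ᵐ[P + Q]
      (P.singularPart Q).rnDeriv (P + Q) + (Q.withDensity (P.rnDeriv Q)).rnDeriv (P + Q) := by
    have := Measure.rnDeriv_add (P.singularPart Q) (Q.withDensity (P.rnDeriv Q)) (P + Q)
    rwa [Measure.singularPart_add_rnDeriv] at this
  have e2 : (Q.withDensity (P.rnDeriv Q)).rnDeriv (P + Q) =ᵐ[P + Q]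
      Q.rnDeriv (P + Q) * P.rnDeriv Q := by
    have h : Q.withDensity (P.rnDeriv Q)
        = (P + Q).withDensity (Q.rnDeriv (P + Q) * P.rnDeriv Q) := by
      rw [withDensity_mul _ (Measure.measurable_rnDeriv _ _) (Measure.measurable_rnDeriv _ _),
        Measure.withDensity_rnDeriv_eq _ _ hQ]
    conv_lhs => rw [h]
    exact Measure.rnDeriv_withDensity _
      ((Measure.measurable_rnDeriv _ _).mul (Measure.measurable_rnDeriv _ _))
  have hz : ∀ (μ : Measure Ω) (A : Set Ω), MeasurableSet A → μ A = 0 →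
      ∀ᵐ x ∂(P + Q), x ∈ A → μ.rnDeriv (P + Q) x = 0 := by
    intro μ A hA hμ
    have h0 : ∫⁻ x in A, μ.rnDeriv (P + Q) x ∂(P + Q) = 0 :=
      le_antisymm ((Measure.setLIntegral_rnDeriv_le A).trans hμ.le) zero_le
    rw [lintegral_eq_zero_iff (Measure.measurable_rnDeriv _ _)] at h0
    exact (ae_restrict_iff' hA).1 h0
  have e3 := hz _ _ hms.measurableSet_nullSet hms.measure_nullSet
  have e4 := hz _ _ hms.measurableSet_nullSet.compl hms.measure_compl_nullSet
  have e5 : ∀ᵐ x ∂(P + Q), Q.rnDeriv (P + Q) x ≠ 0 → P.rnDeriv Q x < ⊤ := by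
    have := Measure.rnDeriv_lt_top P Q
    rw [← Measure.withDensity_rnDeriv_eq _ _ hQ,
      ae_withDensity_iff (Measure.measurable_rnDeriv _ _),
      Measure.withDensity_rnDeriv_eq _ _ hQ] at this
    exact this
  filter_upwards [e1, e2, e3, e4] with x h1 h2 h3 h4
  simp only [Pi.add_apply, Pi.mul_apply, smul_eq_mul] at *
  by_cases hx : x ∈ hms.nullSet
  · rw [h1, h3 hx, zero_add, h2, ENNReal.toReal_mul,
      mul_min_of_nonneg _ _ ENNReal.toReal_nonneg]
  · rw [h4 hx]; simp

theorem integrand_eq {Ω : Type*} [MeasurableSpace Ω] (P Q : Measure Ω)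
    [IsProbabilityMeasure P] [IsProbabilityMeasure Q] (s : ℝ) (hs : 0 < s) :
    ENNReal.ofReal (min 1 s - psiPQ P Q s)
      = ∫⁻ x, ENNReal.ofReal (kker (P.rnDeriv Q x).toReal s) ∂Q
        + (Set.Ioi (1 : ℝ)).indicator (fun _ => P.singularPart Q Set.univ) s := by
  have hR : Integrable (fun x => (P.rnDeriv Q x).toReal) Q := Measure.integrable_toReal_rnDeriv
  have hmin : Integrable (fun x => min (P.rnDeriv Q x).toReal s) Q :=
    hR.inf (integrable_const s)
  have hint : ∫ x, (P.rnDeriv Q x).toReal ∂Q = 1 - (P.singularPart Q).real Set.univ := by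
    rw [Measure.integral_toReal_rnDeriv']; simp
  have hk : Integrable (fun x => kker (P.rnDeriv Q x).toReal s) Q := by
    unfold kker
    split_ifs
    · exact (integrable_const s).sub hmin
    · exact hR.sub hmin
  rw [← ofReal_integral_eq_lintegral_ofReal hk
    (Eventually.of_forall fun x => kker_nonneg _ _), psi_eq P Q s hs]
  have hk0 : 0 ≤ ∫ x, kker (P.rnDeriv Q x).toReal s ∂Q := integral_nonneg fun x => kker_nonneg _ _
  by_cases h : s ≤ 1
  · have : s ∉ Set.Ioi (1:ℝ) := not_lt.2 h
    rw [Set.indicator_of_notMem this, add_zero, min_eq_right h]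
    congr 1
    unfold kker
    simp only [h, if_true]
    rw [integral_sub (integrable_const s) hmin]; simp
  · have h' : s ∈ Set.Ioi (1:ℝ) := not_le.1 h
    rw [Set.indicator_of_mem h', min_eq_left (not_le.1 h).le,
      ← ofReal_measureReal, ← ENNReal.ofReal_add hk0 measureReal_nonneg]
    congr 1
    unfold kker
    simp only [h, if_false]
    rw [integral_sub hR hmin, hint]; ring

theorem Ifun_eq {Ω : Type*} [MeasurableSpace Ω] (P Q : Measure Ω)
    [IsProbabilityMeasure P] [IsProbabilityMeasure Q]
    {f : ℝ → ℝ} {ν : Measure ℝ} (hν : IsCurvatureMeasure f ν) :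
    Ifun ν (psiPQ P Q) = ∫⁻ x, Hfun ν (P.rnDeriv Q x).toReal ∂Q
      + ν (Set.Ioi 1) * P.singularPart Q Set.univ := by
  have := curv_sigmaFinite hν
  have hm : Measurable (fun p : ℝ × Ω => ENNReal.ofReal (kker (P.rnDeriv Q p.2).toReal p.1)) :=
    (measurable_kker.comp
      ((((Measure.measurable_rnDeriv P Q).ennreal_toReal).comp measurable_snd).prodMk
        measurable_fst)).ennreal_ofReal
  unfold Ifun
  rw [setLIntegral_congr_fun measurableSet_Ioi (fun s hs => integrand_eq P Q s hs),
    lintegral_add_right _ (measurable_const.indicator measurableSet_Ioi)]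
  congr 1
  · rw [lintegral_lintegral_swap hm.aemeasurable]
    rfl
  · rw [lintegral_indicator measurableSet_Ioi, lintegral_const,
      Measure.restrict_restrict measurableSet_Ioi, Measure.restrict_apply_univ, mul_comm]
    congr 2
    exact Set.inter_eq_left.2 fun s hs => lt_trans one_pos (Set.mem_Ioi.1 hs)

theorem ereal_distrib (a w : ℝ≥0∞) (b : ℝ) (hw : w ≠ ⊤) :
    ((a : EReal) + (b : EReal)) * (w : EReal)
      = ((a * w : ℝ≥0∞) : EReal) + ((b * w.toReal : ℝ) : EReal) := by
  lift w to ℝ≥0 using hw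
  by_cases ha : a = ⊤
  · subst ha
    by_cases hw0 : w = 0
    · subst hw0; simp
    · have hw1 : (0:ℝ) < (w : ℝ) := by exact_mod_cast pos_iff_ne_zero.2 hw0
      rw [ENNReal.top_mul (by exact_mod_cast hw0), EReal.coe_ennreal_top, EReal.top_add_coe,
        EReal.top_add_coe]
      exact EReal.top_mul_of_pos (by exact_mod_cast pos_iff_ne_zero.2 hw0)
  · lift a to ℝ≥0 using ha
    rw [← ENNReal.coe_mul]
    have e : ∀ z : ℝ≥0, (((z : ℝ≥0∞)) : EReal) = ((z : ℝ) : EReal) := fun z => rfl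
    rw [e, e, e, ← EReal.coe_add, ← EReal.coe_mul, ← EReal.coe_add]
    congr 1
    simp; ring

theorem ereal_final (A B C : ℝ≥0∞) (x y z : ℝ) (h : x + y + z = 0) :
    ((A : EReal) + (x : EReal)) + ((B : EReal) + (y : EReal)) + ((C : EReal) + (z : EReal))
      = ((A + B + C : ℝ≥0∞) : EReal) := by
  have e : ((A : EReal) + (x : EReal)) + ((B : EReal) + (y : EReal)) + ((C : EReal) + (z : EReal))
    = ((A : EReal) + (B : EReal) + (C : EReal)) + ((x : EReal) + (y : EReal) + (z : EReal)) := by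
    abel
  rw [e, ← EReal.coe_add, ← EReal.coe_add, h]
  simp [EReal.coe_ennreal_add]

/-- **Lemma 1 (testing representation).** For every convex `f` with `f(1) = 0` and all
probability measures `P, Q`, one has `D_f(P‖Q) = I_f(ψ_{P,Q})`, i.e.
`D_f(P‖Q) = ∫_{(0,∞)} (min(1,s) - ψ_{P,Q}(s)) dν_f(s)`. -/
theorem fDiv_eq_Ifun_psi {Ω : Type*} [MeasurableSpace Ω] (P Q : Measure Ω)
    [IsProbabilityMeasure P] [IsProbabilityMeasure Q]
    (f : ℝ → ℝ) (hf : ConvexOn ℝ (Set.Ioi 0) f) (hf1 : f 1 = 0)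
    (ν : Measure ℝ) (hν : IsCurvatureMeasure f ν) :
    fDiv f P Q = ((Ifun ν (psiPQ P Q) : ℝ≥0∞) : EReal) := by
  have hmr : Measurable (P.rnDeriv Q) := Measure.measurable_rnDeriv P Q
  have hS : MeasurableSet {x | P.rnDeriv Q x ≠ 0} := hmr (measurableSet_singleton 0).compl
  have hS0 : MeasurableSet {x | P.rnDeriv Q x = 0} := hmr (measurableSet_singleton 0)
  have hSc : {x | P.rnDeriv Q x ≠ 0}ᶜ = {x | P.rnDeriv Q x = 0} := by ext x; simp
  have hR : Integrable (fun x => (P.rnDeriv Q x).toReal) Q := Measure.integrable_toReal_rnDeriv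
  have hint : ∫ x, (P.rnDeriv Q x).toReal ∂Q = 1 - (P.singularPart Q).real Set.univ := by
    rw [Measure.integral_toReal_rnDeriv']; simp
  set c := rightDeriv f 1 with hc
  have hpos : ∀ᵐ x ∂(Q.restrict {x | P.rnDeriv Q x ≠ 0}), 0 < (P.rnDeriv Q x).toReal := by
    rw [ae_restrict_iff' hS]
    filter_upwards [Measure.rnDeriv_lt_top P Q] with x hx hx0
    exact ENNReal.toReal_pos hx0 hx.ne
  have hlin : Integrable (fun x => c * ((P.rnDeriv Q x).toReal - 1))
      (Q.restrict {x | P.rnDeriv Q x ≠ 0}) :=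
    ((hR.sub (integrable_const 1)).const_mul c).restrict
  have hlinv : ∫ x in {x | P.rnDeriv Q x ≠ 0}, c * ((P.rnDeriv Q x).toReal - 1) ∂Q
      = c * (Q {x | P.rnDeriv Q x = 0}).toReal - c * (P.singularPart Q Set.univ).toReal := by
    have h1 := integral_add_compl hS ((hR.sub (integrable_const 1)).const_mul c)
    rw [hSc] at h1
    have h2 : ∫ x in {x | P.rnDeriv Q x = 0}, c * ((P.rnDeriv Q x).toReal - 1) ∂Q
        = - c * (Q {x | P.rnDeriv Q x = 0}).toReal := by
      rw [setIntegral_congr_fun (g := fun _ => -c) hS0]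
      · simp [measureReal_def, mul_comm]
      · intro x hx
        have : P.rnDeriv Q x = 0 := hx
        simp [this]
    have h3 : ∫ x, c * ((P.rnDeriv Q x).toReal - 1) ∂Q
        = - c * (P.singularPart Q Set.univ).toReal := by
      rw [integral_const_mul, integral_sub hR (integrable_const 1), hint]
      simp [measureReal_def]
    simp only [Pi.sub_apply] at h1
    rw [h2, h3] at h1
    linarith
  have hH : ∫⁻ x, Hfun ν (P.rnDeriv Q x).toReal ∂Q
      = ∫⁻ x in {x | P.rnDeriv Q x ≠ 0}, ENNReal.ofReal
          (f (P.rnDeriv Q x).toReal - c * ((P.rnDeriv Q x).toReal - 1)) ∂Q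
        + Hfun ν 0 * Q {x | P.rnDeriv Q x = 0} := by
    rw [← lintegral_add_compl _ hS, hSc]
    congr 1
    · apply lintegral_congr_ae
      filter_upwards [hpos] with x hx
      exact Hfun_eq hf hf1 hν hx
    · rw [setLIntegral_congr_fun (g := fun _ => Hfun ν 0) hS0]
      · simp
      · intro x hx
        have : P.rnDeriv Q x = 0 := hx
        simp [this]
  have hgnn : 0 ≤ᵐ[Q.restrict {x | P.rnDeriv Q x ≠ 0}] fun x =>
      f (P.rnDeriv Q x).toReal - c * ((P.rnDeriv Q x).toReal - 1) := by
    filter_upwards [hpos] with x hx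
    exact tangent_le hf hf1 hx
  rw [Ifun_eq P Q hν, hH]
  unfold fDiv
  rw [limAtZero_eq hf hf1 hν, derivAtTop_eq hf hf1 hν,
    ereal_distrib _ _ _ (measure_ne_top _ _), ereal_distrib _ _ _ (measure_ne_top _ _)]
  by_cases hI : Integrable (fun x => f ((Measure.rnDeriv P Q x).toReal))
      (Q.restrict {x | Measure.rnDeriv P Q x ≠ 0})
  · rw [if_pos hI, ← ereal_final _ _ _ (c * (Q {x | P.rnDeriv Q x = 0}).toReal
        - c * (P.singularPart Q Set.univ).toReal)
      (-c * (Q {x | P.rnDeriv Q x = 0}).toReal) (c * (P.singularPart Q Set.univ).toReal) (by ring)]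
    congr 2
    have hg : Integrable (fun x =>
          f (P.rnDeriv Q x).toReal - c * ((P.rnDeriv Q x).toReal - 1))
          (Q.restrict {x | P.rnDeriv Q x ≠ 0}) := hI.sub hlin
    rw [← ofReal_integral_eq_lintegral_ofReal hg hgnn, EReal.coe_ennreal_ofReal,
      max_eq_left (integral_nonneg_of_ae hgnn), ← EReal.coe_add]
    congr 1
    rw [integral_sub hI hlin, hlinv]; ring
  · rw [if_neg hI]
    have htop : ∫⁻ x in {x | P.rnDeriv Q x ≠ 0}, ENNReal.ofReal
          (f (P.rnDeriv Q x).toReal - c * ((P.rnDeriv Q x).toReal - 1)) ∂Q = ⊤ := by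
      by_contra hne
      apply hI
      have hfm : AEStronglyMeasurable (fun x => f (P.rnDeriv Q x).toReal)
          (Q.restrict {x | P.rnDeriv Q x ≠ 0}) := by
        have hm : Measurable ((Set.Ioi (0:ℝ)).indicator f) := by
          have := (hf.continuousOn isOpen_Ioi).measurable_piecewise
            (continuousOn_const (c := (0:ℝ))) measurableSet_Ioi
          rwa [← Set.piecewise_eq_indicator]
        refine (hm.comp hmr.ennreal_toReal).aestronglyMeasurable.congr ?_
        filter_upwards [hpos] with x hx
        exact Set.indicator_of_mem (Set.mem_Ioi.2 hx) f
      have hg : Integrable (fun x =>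
          f (P.rnDeriv Q x).toReal - c * ((P.rnDeriv Q x).toReal - 1))
          (Q.restrict {x | P.rnDeriv Q x ≠ 0}) := by
        refine ⟨hfm.sub hlin.aestronglyMeasurable, ?_⟩
        rw [hasFiniteIntegral_iff_ofReal hgnn]
        exact lt_top_iff_ne_top.2 hne
      refine (hg.add hlin).congr (Eventually.of_forall fun x => ?_)
      simp
    rw [htop, top_add, top_add, EReal.coe_ennreal_top]
    have nb : ∀ (a : ℝ≥0∞) (b : ℝ), (a : EReal) + (b : EReal) ≠ ⊥ := by
      intro a b
      rw [Ne, EReal.add_eq_bot_iff]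
      simp
    rw [EReal.top_add_of_ne_bot (nb _ _), EReal.top_add_of_ne_bot (nb _ _)]

end
end

section
/- Let P and Q be probability measures with densities p and q with respect to a common σ-finite measure λ, and let ψ = ψ_{P,Q}. Then the left derivative of ψ satisfies ∂^l ψ(s) = Q{p ≥ sq} for every s > 0, and the right derivative satisfies ∂^r ψ(s) = Q{p > sq} for every s ≥ 0. -/
open MeasureTheory Filter Set
open scoped ENNReal NNReal Classical

noncomputable section

theorem psi_slope_aux {Ω : Type*} [MeasurableSpace Ω] (lam : Measure Ω)
    (p q : Ω → ℝ) (hq : Measurable q) (hq0 : ∀ x, 0 ≤ q x)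
    (hpi : Integrable p lam) (hqi : Integrable q lam)
    (Q : Measure Ω) (hQ : Q = lam.withDensity fun x => ENNReal.ofReal (q x))
    (A : Set Ω) (hA : MeasurableSet A) (S : Set ℝ) (s : ℝ) (hs : s ∉ S)
    (hlim : ∀ x, ∀ᶠ t in nhdsWithin s S,
      min (p x) (q x * t) - min (p x) (q x * s) = (t - s) * A.indicator q x) :
    HasDerivWithinAt (fun t => ∫ x, min (p x) (q x * t) ∂lam) ((Q A).toReal) S s := by
  have hint : ∀ t : ℝ, Integrable (fun x => min (p x) (q x * t)) lam :=
    fun t => hpi.inf (hqi.mul_const t)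
  have hQA : (Q A).toReal = ∫ x, A.indicator q x ∂lam := by
    rw [hQ, withDensity_apply _ hA, integral_indicator hA,
      integral_eq_lintegral_of_nonneg_ae (ae_of_all _ hq0) hq.aestronglyMeasurable]
  have hne : ∀ᶠ t in nhdsWithin s S, t ≠ s := by
    filter_upwards [self_mem_nhdsWithin] with t ht h
    exact hs (h ▸ ht)
  rw [hasDerivWithinAt_iff_tendsto_slope' hs, hQA]
  have hslope : (slope (fun t => ∫ x, min (p x) (q x * t) ∂lam) s) =
      fun t => ∫ x, (t - s)⁻¹ * (min (p x) (q x * t) - min (p x) (q x * s)) ∂lam := by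
    funext t
    rw [slope_def_module, integral_const_mul, integral_sub (hint t) (hint s), smul_eq_mul]
  rw [hslope]
  refine tendsto_integral_filter_of_dominated_convergence q ?_ ?_ hqi ?_
  · exact Eventually.of_forall fun t =>
      (((hint t).sub (hint s)).const_mul _).aestronglyMeasurable
  · filter_upwards [hne] with t ht
    refine ae_of_all _ fun x => ?_
    have h1 : |min (p x) (q x * t) - min (p x) (q x * s)| ≤ |q x * t - q x * s| := by
      have := abs_min_sub_min_le_max (p x) (q x * t) (p x) (q x * s)
      simpa using this
    have h2 : |q x * t - q x * s| = q x * |t - s| := by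
      rw [← mul_sub, abs_mul, abs_of_nonneg (hq0 x)]
    have h3 : 0 < |t - s| := abs_pos.2 (sub_ne_zero.2 ht)
    rw [Real.norm_eq_abs, abs_mul, abs_inv, inv_mul_le_iff₀ h3]
    linarith
  · refine ae_of_all _ fun x => ?_
    refine tendsto_const_nhds.congr' ?_
    filter_upwards [hlim x, hne] with t ht h
    rw [ht, inv_mul_cancel_left₀ (sub_ne_zero.2 h)]

theorem psi_integrable_aux {Ω : Type*} [MeasurableSpace Ω] (lam : Measure Ω)
    (p : Ω → ℝ) (hp : Measurable p) (hp0 : ∀ x, 0 ≤ p x)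
    (P : Measure Ω) (hP : P = lam.withDensity fun x => ENNReal.ofReal (p x))
    [IsProbabilityMeasure P] : Integrable p lam := by
  refine ⟨hp.aestronglyMeasurable, ?_⟩
  rw [hasFiniteIntegral_iff_ofReal (ae_of_all _ hp0)]
  have h : P univ = 1 := measure_univ
  rw [hP, withDensity_apply _ MeasurableSet.univ, Measure.restrict_univ] at h
  rw [h]
  exact ENNReal.one_lt_top

/-- **Lemma 2 (derivatives of `ψ_{P,Q}`).** If `P, Q` have densities `p, q` with respect to a
common σ-finite measure `λ` and `ψ(s) = ∫ min(p, q s) dλ`, then the left derivative of `ψ` at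
every `s > 0` is `Q{p ≥ s q}` and the right derivative at every `s ≥ 0` is `Q{p > s q}`. -/
theorem psi_hasDeriv {Ω : Type*} [MeasurableSpace Ω] (lam : Measure Ω) [SigmaFinite lam]
    (p q : Ω → ℝ) (hp : Measurable p) (hq : Measurable q)
    (hp0 : ∀ x, 0 ≤ p x) (hq0 : ∀ x, 0 ≤ q x)
    (P Q : Measure Ω)
    (hP : P = lam.withDensity fun x => ENNReal.ofReal (p x))
    (hQ : Q = lam.withDensity fun x => ENNReal.ofReal (q x))
    [IsProbabilityMeasure P] [IsProbabilityMeasure Q] :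
    (∀ s : ℝ, 0 < s →
      HasDerivWithinAt (fun t => ∫ x, min (p x) (q x * t) ∂lam)
        ((Q {x | s * q x ≤ p x}).toReal) (Set.Iio s) s) ∧
    (∀ s : ℝ, 0 ≤ s →
      HasDerivWithinAt (fun t => ∫ x, min (p x) (q x * t) ∂lam)
        ((Q {x | s * q x < p x}).toReal) (Set.Ioi s) s) := by
  have hpi := psi_integrable_aux lam p hp hp0 P hP
  have hqi := psi_integrable_aux lam q hq hq0 Q hQ
  constructor
  · intro s _
    refine psi_slope_aux lam p q hq hq0 hpi hqi Q hQ _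
      (measurableSet_le (hq.const_mul s) hp) _ s (by simp) fun x => ?_
    by_cases h : s * q x ≤ p x
    · filter_upwards [self_mem_nhdsWithin] with t ht
      have ht' : t < s := ht
      have h2 := mul_le_mul_of_nonneg_left ht'.le (hq0 x)
      rw [indicator_of_mem (by exact h), min_eq_right (by linarith), min_eq_right (by linarith)]
      ring
    · have hc : ∀ᶠ t in nhds s, p x < q x * t :=
        (continuous_const_mul (q x)).continuousAt.eventually_const_lt
          (by linarith)
      filter_upwards [nhdsWithin_le_nhds hc] with t ht
      rw [indicator_of_notMem (by exact h), min_eq_left (by linarith), min_eq_left (by linarith)]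
      ring
  · intro s _
    refine psi_slope_aux lam p q hq hq0 hpi hqi Q hQ _
      (measurableSet_lt (hq.const_mul s) hp) _ s (by simp) fun x => ?_
    by_cases h : s * q x < p x
    · have hc : ∀ᶠ t in nhds s, q x * t < p x :=
        (continuous_const_mul (q x)).continuousAt.eventually_lt_const
          (by linarith)
      filter_upwards [nhdsWithin_le_nhds hc] with t ht
      rw [indicator_of_mem (by exact h), min_eq_right (by linarith), min_eq_right (by linarith)]
      ring
    · filter_upwards [self_mem_nhdsWithin] with t ht
      have ht' : s < t := ht
      have h2 := mul_le_mul_of_nonneg_left ht'.le (hq0 x)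
      rw [indicator_of_notMem (by exact h), min_eq_left (by linarith), min_eq_left (by linarith)]
      ring

end
end
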